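/- arXiv:2006.10382 — 6 statements merged into one kernel-verified Lean document; each statement's English description precedes it below -/
import Mathlib

section
/- For every natural number t ≥ 0: if 𝒮 is a family of 5-dimensional linear subspaces of F₂^(8+5t) such that U ⊓ W = {0} for all distinct U, W ∈ 𝒮 (i.e., 𝒮 is a partial 5-spread), then the cardinality of 𝒮 is at most 3 + 2^8 · (∑_{i=0}^{t−1} 32^i). Equivalently, A₂(8+5t, 10; 5) ≤ 3 + 2^8 · (32^t − 1)/31. -/
namespace PSB

def chi (a : ZMod 2) : ℤ := if a = 0 then 1 else -1

lemma chi_add (a b : ZMod 2) : chi (a + b) = chi a * chi b := by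
  revert a b; decide

lemma chi_zero : chi 0 = 1 := by decide

lemma chi_cases (a : ZMod 2) : chi a = 1 ∨ chi a = -1 := by
  revert a; decide

lemma chi_ne (a : ZMod 2) (h : a ≠ 0) : chi a = -1 := by
  simp [chi, h]

lemma sum_chi {G : Type*} [AddCommGroup G] [Fintype G] (φ : G →+ ZMod 2) :
    ((∀ g, φ g = 0) ∧ ∑ g, chi (φ g) = Fintype.card G) ∨
    ((∃ g, φ g ≠ 0) ∧ ∑ g, chi (φ g) = 0) := by
  by_cases h : ∀ g, φ g = 0
  · left
    refine ⟨h, ?_⟩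
    simp [h, chi_zero]
  · right
    push Not at h
    refine ⟨h, ?_⟩
    obtain ⟨g0, hg⟩ := h
    have h1 : ∑ g, chi (φ g) = ∑ g, chi (φ (g0 + g)) :=
      (Equiv.sum_comp (Equiv.addLeft g0) (fun g => chi (φ g))).symm
    simp only [map_add, chi_add, chi_ne _ hg, neg_mul, one_mul, Finset.sum_neg_distrib] at h1
    linarith

abbrev V (n : ℕ) := Fin n → ZMod 2

variable {n : ℕ}

def S (N : Finset (V n)) (f : V n) : ℤ := ∑ x ∈ N, chi (f ⬝ᵥ x)

def Q (n : ℕ) : ℤ := 2 ^ n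

lemma Q_pos : 0 < Q n := by unfold Q; positivity

lemma cardV : ((Fintype.card (V n) : ℕ) : ℤ) = Q n := by
  simp [Q, V, ZMod.card]

def dotL (x : V n) : V n →+ ZMod 2 where
  toFun f := f ⬝ᵥ x
  map_zero' := by simp
  map_add' := by intro a b; simp [add_dotProduct]

def dotR (f : V n) : V n →+ ZMod 2 where
  toFun x := f ⬝ᵥ x
  map_zero' := by simp
  map_add' := by intro a b; simp [dotProduct_add]

lemma m0 (x : V n) (hx : x ≠ 0) : ∑ f : V n, chi (f ⬝ᵥ x) = 0 := by
  rcases sum_chi (dotL x) with ⟨h, _⟩ | ⟨_, h⟩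
  · exact absurd (dotProduct_eq_zero x (fun w => by rw [dotProduct_comm]; exact h w)) hx
  · exact h

lemma m0z : ∑ f : V n, chi (f ⬝ᵥ (0 : V n)) = Q n := by
  simp [chi_zero, Q, ZMod.card]

lemma m0_nonneg (x : V n) : 0 ≤ ∑ f : V n, chi (f ⬝ᵥ x) := by
  by_cases hx : x = 0
  · subst hx; rw [m0z]; exact Q_pos.le
  · rw [m0 x hx]

lemma m1 (N : Finset (V n)) (h0 : (0 : V n) ∉ N) : ∑ f, S N f = 0 := by
  unfold S
  rw [Finset.sum_comm]
  exact Finset.sum_eq_zero fun x hx => m0 x (fun h => h0 (h ▸ hx))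

lemma V_add_eq_zero (x y : V n) : x + y = 0 ↔ y = x := by
  constructor
  · intro h
    funext i
    have := congrFun h i
    simp only [Pi.add_apply, Pi.zero_apply] at this
    generalize x i = a at *
    generalize y i = b at *
    revert a b; decide
  · rintro rfl
    funext i
    simp only [Pi.add_apply, Pi.zero_apply]
    generalize y i = b
    revert b; decide

lemma m1x (N : Finset (V n)) (x : V n) (hx : x ∈ N) :
    ∑ f, chi (f ⬝ᵥ x) * S N f = Q n := by
  unfold S
  simp only [Finset.mul_sum, ← chi_add, ← dotProduct_add]
  rw [Finset.sum_comm, Finset.sum_eq_single_of_mem x hx]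
  · rw [(V_add_eq_zero x x).2 rfl, m0z]
  · intro y _ hy
    exact m0 _ (fun h => hy ((V_add_eq_zero x y).1 h))

lemma m2 (N : Finset (V n)) : ∑ f, S N f ^ 2 = N.card * Q n := by
  have : ∀ f, S N f ^ 2 = ∑ x ∈ N, chi (f ⬝ᵥ x) * S N f := by
    intro f
    rw [← Finset.sum_mul, sq]; rfl
  simp only [this]
  rw [Finset.sum_comm, Finset.sum_congr rfl (fun x hx => m1x N x hx)]
  simp

lemma m2x (N : Finset (V n)) (x : V n) : 0 ≤ ∑ f, chi (f ⬝ᵥ x) * S N f ^ 2 := by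
  unfold S
  simp only [sq, Finset.mul_sum, Finset.sum_mul, ← chi_add, ← dotProduct_add]
  rw [Finset.sum_comm]
  refine Finset.sum_nonneg fun y _ => ?_
  rw [Finset.sum_comm]
  exact Finset.sum_nonneg fun z _ => m0_nonneg _

lemma m3 (N : Finset (V n)) : 0 ≤ ∑ f, S N f ^ 3 := by
  have : ∀ f, S N f ^ 3 = ∑ x ∈ N, chi (f ⬝ᵥ x) * S N f ^ 2 := by
    intro f
    rw [← Finset.sum_mul, pow_succ']; rfl
  simp only [this]
  rw [Finset.sum_comm]
  exact Finset.sum_nonneg fun x _ => m2x N x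

lemma S_le (N : Finset (V n)) (f : V n) : S N f ≤ N.card := by
  unfold S
  have : ∑ x ∈ N, chi (f ⬝ᵥ x) ≤ ∑ x ∈ N, (1 : ℤ) :=
    Finset.sum_le_sum fun x _ => by rcases chi_cases (f ⬝ᵥ x) with h | h <;> omega
  simpa using this

lemma le_S (N : Finset (V n)) (f : V n) : -(N.card : ℤ) ≤ S N f := by
  unfold S
  have : ∑ x ∈ N, (-1 : ℤ) ≤ ∑ x ∈ N, chi (f ⬝ᵥ x) :=
    Finset.sum_le_sum fun x _ => by rcases chi_cases (f ⬝ᵥ x) with h | h <;> omega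
  simpa using this

lemma exists_of_ne (N : Finset (V n)) (f : V n) (h : S N f ≠ N.card) :
    ∃ x ∈ N, chi (f ⬝ᵥ x) = -1 := by
  by_contra! hc
  apply h
  unfold S
  rw [Finset.sum_congr rfl (fun x hx => (chi_cases (f ⬝ᵥ x)).resolve_right (hc x hx))]
  simp

lemma chi_of_eq (N : Finset (V n)) (f : V n) (h : S N f = N.card) :
    ∀ x ∈ N, chi (f ⬝ᵥ x) = 1 := by
  intro x hx
  by_contra hc
  have h2 : S N f < ∑ x ∈ N, (1 : ℤ) := by
    unfold S
    refine Finset.sum_lt_sum (fun y _ => ?_) ⟨x, hx, ?_⟩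
    · rcases chi_cases (f ⬝ᵥ y) with h | h <;> omega
    · rcases chi_cases (f ⬝ᵥ x) with h | h <;> omega
  simp at h2
  omega

/-- restriction to the hyperplane of f -/
def R (N : Finset (V n)) (f : V n) : Finset (V n) := N.filter fun x => f ⬝ᵥ x = 0

lemma S_R (N : Finset (V n)) (f g : V n) : 2 * S (R N f) g = S N g + S N (f + g) := by
  unfold S R
  rw [Finset.sum_filter, Finset.mul_sum, ← Finset.sum_add_distrib]
  refine Finset.sum_congr rfl fun x _ => ?_
  rw [add_dotProduct, chi_add]
  by_cases h : f ⬝ᵥ x = 0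
  · simp [h, chi_zero]; ring
  · simp [h, chi_ne _ h]

lemma S_zero (N : Finset (V n)) : S N 0 = N.card := by
  simp [S, chi_zero]

lemma card_R (N : Finset (V n)) (f : V n) : 2 * ((R N f).card : ℤ) = N.card + S N f := by
  rw [← S_zero, S_R, S_zero]; simp

lemma zero_R (N : Finset (V n)) (f : V n) (h : (0 : V n) ∉ N) : (0 : V n) ∉ R N f := by
  simp [R, h]

def Dv (N : Finset (V n)) (d : ℤ) : Prop := ∀ f, 2 * d ∣ (N.card : ℤ) - S N f

lemma Dv_R (N : Finset (V n)) (f : V n) (d : ℤ) (h : Dv N (2 * d)) : Dv (R N f) d := by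
  intro g
  obtain ⟨a, ha⟩ := h f
  obtain ⟨b, hb⟩ := h g
  obtain ⟨c, hc⟩ := h (f + g)
  have h1 := card_R N f
  have h2 := S_R N f g
  refine ⟨b + c - a, ?_⟩
  linarith

/-- quadratic moment -/
lemma quad (N : Finset (V n)) (h0 : (0 : V n) ∉ N) (b c : ℤ) :
    ∑ f, (S N f ^ 2 + b * S N f + c) = (N.card + c) * Q n := by
  rw [Finset.sum_add_distrib, Finset.sum_add_distrib, ← Finset.mul_sum, m1 N h0, m2]
  simp only [Finset.sum_const, Finset.card_univ, nsmul_eq_mul, cardV]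
  ring

lemma cubic (N : Finset (V n)) (h0 : (0 : V n) ∉ N) (a b c : ℤ) :
    (a * N.card + c) * Q n ≤ ∑ f, (S N f ^ 3 + a * S N f ^ 2 + b * S N f + c) := by
  rw [Finset.sum_add_distrib, Finset.sum_add_distrib, Finset.sum_add_distrib, ← Finset.mul_sum,
    ← Finset.mul_sum, m1 N h0, m2]
  simp only [Finset.sum_const, Finset.card_univ, nsmul_eq_mul, cardV]
  have := m3 N
  linarith

lemma quad_neg (N : Finset (V n)) (h0 : (0 : V n) ∉ N) (b c : ℤ) (hc : N.card + c < 0)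
    (h : ∀ f, 0 ≤ S N f ^ 2 + b * S N f + c) : False := by
  have h1 := quad N h0 b c
  have h2 : 0 ≤ ∑ f, (S N f ^ 2 + b * S N f + c) := Finset.sum_nonneg fun f _ => h f
  have h3 := Q_pos (n := n)
  nlinarith

lemma small4 (N : Finset (V n)) (h0 : (0 : V n) ∉ N) (hd : Dv N 4) (h3 : (N.card : ℤ) % 8 = 3) :
    15 ≤ (N.card : ℤ) := by
  by_contra! hc
  refine quad_neg N h0 2 (-15) (by linarith) fun f => ?_
  have := hd f
  have : S N f ≤ -5 ∨ 3 ≤ S N f := by omega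
  rcases this with h | h <;> nlinarith

lemma small8 (N : Finset (V n)) (h0 : (0 : V n) ∉ N) (hd : Dv N 8) (h3 : (N.card : ℤ) % 16 = 3) :
    39 ≤ (N.card : ℤ) := by
  by_contra! hc
  refine quad_neg N h0 10 (-39) (by linarith) fun f => ?_
  have := hd f
  have : S N f ≤ -13 ∨ 3 ≤ S N f := by omega
  rcases this with h | h <;> nlinarith

/-- number of functionals vanishing on N -/
def z (N : Finset (V n)) : ℤ := ∑ f, if S N f = N.card then 1 else 0

lemma S_add_ann (N : Finset (V n)) (f u : V n) (hu : S N u = N.card) : S N (f + u) = S N f := by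
  unfold S
  refine Finset.sum_congr rfl fun x hx => ?_
  rw [add_dotProduct, chi_add, chi_of_eq N u hu x hx, mul_one]

lemma values51 (N : Finset (V n)) (h0 : (0 : V n) ∉ N) (hd : Dv N 8) (hc : (N.card : ℤ) = 51)
    (f : V n) : S N f = 51 ∨ S N f = 35 ∨ S N f = 19 ∨ S N f = 3 ∨ S N f = -13 := by
  have h1 := hd f
  have h2 := S_le N f
  have h3 := le_S N f
  have h4 := card_R N f
  have h5 := small4 (R N f) (zero_R N f h0) (Dv_R N f 4 hd)
  omega

lemma key51 (N : Finset (V n)) (h0 : (0 : V n) ∉ N) (hd : Dv N 8) (hc : (N.card : ℤ) = 51)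
    (f : V n) (hf : S N f ≠ 51) : (S N f ^ 2 + 10 * S N f - 39) * z N ≤ Q n := by
  obtain ⟨x, hx, hfx⟩ := exists_of_ne N f (by rw [hc]; exact hf)
  have hx0 : x ≠ 0 := fun h => h0 (h ▸ hx)
  have hpos : ∀ g, 0 ≤ S N g ^ 2 + 10 * S N g - 39 := by
    intro g
    rcases values51 N h0 hd hc g with h | h | h | h | h <;> rw [h] <;> norm_num
  have e1 : ∑ g, (1 - chi (g ⬝ᵥ x)) * (S N g ^ 2 + 10 * S N g - 39) ≤ 2 * Q n := by
    have q := quad N h0 10 (-39)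
    have a1 := m1x N x hx
    have a2 := m2x N x
    have a0 := m0 x hx0
    have : ∑ g, (1 - chi (g ⬝ᵥ x)) * (S N g ^ 2 + 10 * S N g - 39)
      = ∑ g, (S N g ^ 2 + 10 * S N g + -39) - ∑ g, chi (g ⬝ᵥ x) * S N g ^ 2
        - 10 * ∑ g, chi (g ⬝ᵥ x) * S N g + 39 * ∑ g, chi (g ⬝ᵥ x) := by
      simp only [Finset.mul_sum, ← Finset.sum_sub_distrib, ← Finset.sum_add_distrib]
      exact Finset.sum_congr rfl fun g _ => by ring
    rw [this, q, a1, a0, hc]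
    linarith
  have e2 : ∑ g, (1 - chi (g ⬝ᵥ x)) * (S N g ^ 2 + 10 * S N g - 39)
      = ∑ u, (1 - chi ((f + u) ⬝ᵥ x)) * (S N (f + u) ^ 2 + 10 * S N (f + u) - 39) :=
    (Equiv.sum_comp (Equiv.addLeft f)
      (fun g => (1 - chi (g ⬝ᵥ x)) * (S N g ^ 2 + 10 * S N g - 39))).symm
  have e3 : 2 * (S N f ^ 2 + 10 * S N f - 39) * z N ≤
      ∑ u, (1 - chi ((f + u) ⬝ᵥ x)) * (S N (f + u) ^ 2 + 10 * S N (f + u) - 39) := by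
    unfold z
    rw [Finset.mul_sum]
    refine Finset.sum_le_sum fun u _ => ?_
    by_cases hu : S N u = N.card
    · rw [if_pos hu, S_add_ann N f u hu, add_dotProduct, chi_add, chi_of_eq N u hu x hx, hfx]
      linarith
    · rw [if_neg hu, mul_zero]
      refine mul_nonneg ?_ (hpos _)
      rcases chi_cases ((f + u) ⬝ᵥ x) with h | h <;> rw [h] <;> norm_num
  linarith

lemma two51 (N : Finset (V n)) (h0 : (0 : V n) ∉ N) (hd : Dv N 8) (hc : (N.card : ℤ) = 51)
    (f : V n) : S N f = 51 ∨ S N f = 3 ∨ S N f = -13 := by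
  have hQ := Q_pos (n := n)
  have no35 : ∀ f, S N f ≠ 35 := by
    intro f hf
    have k := key51 N h0 hd hc f (by omega)
    rw [hf] at k
    have c := cubic N h0 (-25) (-389) 1365
    have : ∑ f, (S N f ^ 3 + (-25) * S N f ^ 2 + (-389) * S N f + 1365) ≤ 49152 * z N := by
      unfold z
      rw [Finset.mul_sum]
      refine Finset.sum_le_sum fun u _ => ?_
      rw [hc]
      rcases values51 N h0 hd hc u with h | h | h | h | h <;> rw [h] <;> norm_num
    rw [hc] at c
    linarith
  have no19 : ∀ f, S N f ≠ 19 := by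
    intro f hf
    have k := key51 N h0 hd hc f (by omega)
    rw [hf] at k
    have c := cubic N h0 (-9) (-229) 741
    have : ∑ f, (S N f ^ 3 + (-9) * S N f ^ 2 + (-229) * S N f + 741) ≤ 98304 * z N := by
      unfold z
      rw [Finset.mul_sum]
      refine Finset.sum_le_sum fun u _ => ?_
      rw [hc]
      rcases values51 N h0 hd hc u with h | h | h | h | h
      · rw [h]; norm_num
      · exact absurd h (no35 u)
      all_goals rw [h]; norm_num
    rw [hc] at c
    linarith
  have := values51 N h0 hd hc f
  have := no35 f
  have := no19 f
  omega

lemma no131 (N : Finset (V n)) (h0 : (0 : V n) ∉ N) (hd : Dv N 16) (hc : (N.card : ℤ) = 131) :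
    False := by
  have hQ := Q_pos (n := n)
  have vals : ∀ f, S N f = 131 ∨ S N f = 99 ∨ S N f = 67 ∨ S N f = 35 ∨ S N f = 3 ∨
      S N f = -29 := by
    intro f
    have h1 := hd f
    have h2 := S_le N f
    have h3 := le_S N f
    have h4 := card_R N f
    have h5 := small8 (R N f) (zero_R N f h0) (Dv_R N f 8 hd)
    omega
  have two : ∀ c g, S N c = -29 → S N g + S N (c + g) = 102 ∨ S N g + S N (c + g) = 6 ∨
      S N g + S N (c + g) = -26 := by
    intro c g hcc
    have h4 := card_R N c
    have := two51 (R N c) (zero_R N c h0) (Dv_R N c 8 hd) (by omega) g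
    have := S_R N c g
    omega
  have no1 : ∀ h, S N h ≠ 99 ∧ S N h ≠ 67 := by
    intro h
    by_contra hcon
    have hh : S N h = 99 ∨ S N h = 67 := by omega
    obtain ⟨x, hx, hhx⟩ := exists_of_ne N h (by omega)
    have hx0 : x ≠ 0 := fun h => h0 (h ▸ hx)
    have h29 : ∀ c, S N c = -29 → chi (c ⬝ᵥ x) = -1 := by
      intro c hcc
      have t := two c h hcc
      have v := vals (c + h)
      have h4 := card_R N c
      have hs := S_R N c h
      have hall := chi_of_eq (R N c) h (by omega)
      by_contra hne
      have hcx : c ⬝ᵥ x = 0 := by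
        by_contra h'
        exact hne (chi_ne _ h')
      have := hall x (by simp [R, hx, hcx])
      omega
    have a1 := m1x N x hx
    have a0 := m0 x hx0
    have b1 := m1 N h0
    have e : ∑ f, (1 + chi (f ⬝ᵥ x)) * (S N f - 3) = -2 * Q n := by
      have : ∑ f, (1 + chi (f ⬝ᵥ x)) * (S N f - 3) = ∑ f, S N f + ∑ f, chi (f ⬝ᵥ x) * S N f
          - 3 * ∑ f, chi (f ⬝ᵥ x) - ∑ f : V n, 3 := by
        simp only [Finset.mul_sum, ← Finset.sum_sub_distrib, ← Finset.sum_add_distrib]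
        exact Finset.sum_congr rfl fun g _ => by ring
      rw [this, a1, a0, b1]
      simp only [Finset.sum_const, Finset.card_univ, nsmul_eq_mul, cardV]
      ring
    have p : 0 ≤ ∑ f, (1 + chi (f ⬝ᵥ x)) * (S N f - 3) := by
      refine Finset.sum_nonneg fun f _ => ?_
      by_cases h9 : S N f = -29
      · rw [h29 f h9]; norm_num
      · refine mul_nonneg ?_ ?_
        · rcases chi_cases (f ⬝ᵥ x) with h | h <;> rw [h] <;> norm_num
        · have := vals f
          omega
    linarith
  have no2 : ∀ h, S N h ≠ 35 := by
    intro h hh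
    have h4 := card_R N h
    refine quad_neg (R N h) (zero_R N h h0) 26 (-87) (by omega) fun f => ?_
    have hs := S_R N h f
    have v1 := vals f
    have v2 := vals (h + f)
    have n1 := no1 f
    have n2 := no1 (h + f)
    have t1 := two f h
    have t2 := two (h + f) h
    have e1 : f + h = h + f := add_comm _ _
    have e2 : h + f + h = f := by
      rw [add_comm h f, add_assoc, (V_add_eq_zero h h).2 rfl, add_zero]
    rw [e1] at t1
    rw [e2] at t2
    have : S (R N h) f ≤ -29 ∨ 3 ≤ S (R N h) f := by omega
    rcases this with h | h <;> nlinarith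
  have q := quad N h0 26 (-87)
  have : ∑ f, (S N f ^ 2 + 26 * S N f + -87) = 20480 * z N := by
    unfold z
    rw [Finset.mul_sum]
    refine Finset.sum_congr rfl fun u _ => ?_
    have := no1 u
    have := no2 u
    have : S N u = 131 ∨ S N u = 3 ∨ S N u = -29 := by
      have := vals u
      omega
    rw [hc]
    rcases this with h | h | h <;> rw [h] <;> norm_num
  rw [this, hc] at q
  have d : (5 : ℤ) ∣ 11 * 2 ^ n := ⟨1024 * z N, by unfold Q at q; linarith⟩
  have p5 : Prime (5 : ℤ) := by norm_num
  rcases p5.dvd_or_dvd d with h | h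
  · omega
  · have := p5.dvd_of_dvd_pow h
    omega

open Classical in
lemma holes (s k : ℕ) (hk : Q n = 32 * k) (hq : Q n = 256 + 256 * 31 * s)
    (T : Finset (Submodule (ZMod 2) (V n)))
    (hdim : ∀ U ∈ T, Module.finrank (ZMod 2) U = 5)
    (hdisj : ∀ U ∈ T, ∀ W ∈ T, U ≠ W → U ⊓ W = ⊥)
    (hT : T.card = 4 + 256 * s) : False := by
  have cU : ∀ U ∈ T, ((Fintype.card U : ℕ) : ℤ) = 32 := by
    intro U hU
    have := Module.card_eq_pow_finrank (K := ZMod 2) (V := U)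
    rw [hdim U hU] at this
    rw [this]; simp [ZMod.card]
  let P : Submodule (ZMod 2) (V n) → Finset (V n) := fun U => Finset.univ.filter fun x => x ∈ U ∧ x ≠ 0
  let N : Finset (V n) := Finset.univ.filter fun x => x ≠ 0 ∧ ∀ U ∈ T, x ∉ U
  have h0 : (0 : V n) ∉ N := by simp [N]
  have sP : ∀ U f, S (P U) f = ∑ x : U, chi (f ⬝ᵥ (x : V n)) - 1 := by
    intro U f
    have : ∑ x : U, chi (f ⬝ᵥ (x : V n)) = ∑ x ∈ Finset.univ.filter (fun x => x ∈ U), chi (f ⬝ᵥ x) := by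
      symm
      apply Finset.sum_subtype
      simp
    rw [this]
    have h2 : Finset.univ.filter (fun x => x ∈ U) = insert 0 (P U) := by
      ext x
      simp only [P, Finset.mem_filter, Finset.mem_univ, true_and, Finset.mem_insert]
      by_cases hx : x = 0
      · simp [hx]
      · simp [hx]
    rw [h2, Finset.sum_insert (by simp [P])]
    simp [S, chi_zero]
  have hpd : (T : Set (Submodule (ZMod 2) (V n))).PairwiseDisjoint P := by
    intro U hU W hW hne
    rw [Function.onFun, Finset.disjoint_left]
    intro x hx hx'
    simp only [P, Finset.mem_filter, Finset.mem_univ, true_and] at hx hx'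
    have : x ∈ U ⊓ W := ⟨hx.1, hx'.1⟩
    rw [hdisj U hU W hW hne] at this
    exact hx.2 (by simpa using this)
  have huniv : (Finset.univ : Finset (V n)) = insert 0 (N ∪ T.biUnion P) := by
    ext x
    simp only [N, P, Finset.mem_univ, Finset.mem_insert, Finset.mem_union, Finset.mem_filter,
      Finset.mem_biUnion, true_and, true_iff]
    by_cases hx : x = 0
    · simp [hx]
    · by_cases h : ∃ U ∈ T, x ∈ U
      · obtain ⟨U, hU, hxU⟩ := h
        exact Or.inr (Or.inr ⟨U, hU, hxU, hx⟩)
      · push Not at h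
        exact Or.inr (Or.inl ⟨hx, h⟩)
  have hND : Disjoint N (T.biUnion P) := by
    rw [Finset.disjoint_left]
    intro x hx hx'
    simp only [N, P, Finset.mem_filter, Finset.mem_biUnion, Finset.mem_univ, true_and] at hx hx'
    obtain ⟨U, hU, hxU, _⟩ := hx'
    exact hx.2 U hU hxU
  have total : ∀ f : V n, ∑ x : V n, chi (f ⬝ᵥ x) = 1 + (S N f +
      (∑ U ∈ T, ∑ x : U, chi (f ⬝ᵥ (x : V n)) - T.card)) := by
    intro f
    rw [huniv, Finset.sum_insert (by simp [N, P]), Finset.sum_union hND, Finset.sum_biUnion hpd]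
    have : ∑ U ∈ T, ∑ x ∈ P U, chi (f ⬝ᵥ x) = ∑ U ∈ T, (∑ x : U, chi (f ⬝ᵥ (x : V n)) - 1) :=
      Finset.sum_congr rfl fun U _ => sP U f
    rw [this, Finset.sum_sub_distrib]
    simp [S, chi_zero]
  have hcard : (N.card : ℤ) = 131 := by
    have t := total 0
    rw [S_zero] at t
    simp only [zero_dotProduct, chi_zero, Finset.sum_const, Finset.card_univ, nsmul_eq_mul, mul_one, cardV] at t
    rw [Finset.sum_congr rfl cU, hT, hq] at t
    simp only [Finset.sum_const, hT, nsmul_eq_mul] at t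
    push_cast at t
    linarith
  refine no131 N h0 (fun f => ?_) hcard
  have t := total f
  have d1 : (32 : ℤ) ∣ ∑ x : V n, chi (f ⬝ᵥ x) := by
    rcases sum_chi (dotR f) with ⟨_, h⟩ | ⟨_, h⟩
    · refine ⟨k, ?_⟩
      rw [← hk, ← cardV]
      exact h
    · exact ⟨0, h⟩
  have d2 : (32 : ℤ) ∣ ∑ U ∈ T, ∑ x : U, chi (f ⬝ᵥ (x : V n)) := by
    refine Finset.dvd_sum fun U hU => ?_
    rcases sum_chi ((dotR f).comp U.subtype.toAddMonoidHom) with ⟨_, h⟩ | ⟨_, h⟩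
    · refine ⟨1, ?_⟩
      rw [mul_one, ← cU U hU]
      exact h
    · exact ⟨0, h⟩
  rw [hT] at t
  push_cast at t
  omega

end PSB

/-- Upper bound on partial 5-spreads in `F₂^(8+5t)`:
`A₂(8+5t, 10; 5) ≤ 3 + 2^8 · (32^t − 1)/31`. -/
theorem partial_spread_bound (t : ℕ)
    (𝒮 : Finset (Submodule (ZMod 2) (Fin (8 + 5 * t) → ZMod 2)))
    (hdim : ∀ U ∈ 𝒮, Module.finrank (ZMod 2) U = 5)
    (hdisj : ∀ U ∈ 𝒮, ∀ W ∈ 𝒮, U ≠ W → U ⊓ W = ⊥) :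
    𝒮.card ≤ 3 + 2 ^ 8 * ∑ i ∈ Finset.range t, 32 ^ i := by
  by_contra! hcon
  obtain ⟨T, hTS, hT⟩ := Finset.exists_subset_card_eq
    (show 4 + 256 * ∑ i ∈ Finset.range t, 32 ^ i ≤ 𝒮.card by omega)
  have hg : ∀ t : ℕ, (32 : ℤ) ^ t = 1 + 31 * ((∑ i ∈ Finset.range t, 32 ^ i : ℕ) : ℤ) := by
    intro t
    induction t with
    | zero => simp
    | succ m ih =>
      rw [Finset.sum_range_succ, pow_succ]
      push_cast at ih ⊢
      linarith
  have hQ : PSB.Q (8 + 5 * t) = 256 * 32 ^ t := by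
    unfold PSB.Q
    rw [pow_add, pow_mul]
    norm_num
  refine PSB.holes (∑ i ∈ Finset.range t, 32 ^ i) (8 * 32 ^ t) ?_ ?_ T
    (fun U hU => hdim U (hTS hU)) (fun U hU W hW => hdisj U (hTS hU) W (hTS hW)) hT
  · rw [hQ]; push_cast; ring
  · rw [hQ, hg t]; ring
end

section
/- If 𝒮 is a family of 6-dimensional linear subspaces of F₂^14 such that for all distinct U, W ∈ 𝒮 the subspace distance dim(U) + dim(W) − 2·dim(U ⊓ W) is at least 10, then the cardinality of 𝒮 is at most 67349. Equivalently, A₂(14, 10; 6) ≤ 67349. -/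
namespace CDC
open Finset

abbrev V := Fin 14 → ZMod 2

/-- 0/1 integer value of a bit -/
def v (x : ZMod 2) : ℤ := if x = 1 then 1 else 0

lemma v_two (x y : ZMod 2) : 2 * (v x * v y) = v x + v y - v (x + y) := by
  revert x y; decide
lemma v_three (x y z : ZMod 2) : 4 * (v x * v y * v z) =
    v x + v y + v z - v (x + y) - v (x + z) - v (y + z) + v (x + y + z) := by
  revert x y z; decide
lemma v_res (x y : ZMod 2) : 2 * (if x = 0 then v y else 0) = v y + v (x + y) - v x := by
  revert x y; decide
lemma v_res1 (x : ZMod 2) : (if x = 0 then (1:ℤ) else 0) = 1 - v x := by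
  revert x; decide
lemma v_flip (x : ZMod 2) : v (x + 1) = 1 - v x := by
  revert x; decide
lemma v_nonneg (x : ZMod 2) : 0 ≤ v x := by revert x; decide
lemma v_le (x : ZMod 2) : v x ≤ 1 := by revert x; decide

lemma cardV : Fintype.card V = 16384 := by
  simp [V, ZMod.card]

lemma add_self (x : V) : x + x = 0 := by
  funext i; exact CharTwo.add_self_eq_zero (x i)

lemma exists_dot {p : V} (hp : p ≠ 0) : ∃ g : V, g ⬝ᵥ p = 1 := by
  obtain ⟨i, hi⟩ := Function.ne_iff.mp hp
  refine ⟨Pi.single i 1, ?_⟩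
  rw [single_dotProduct, one_mul]
  have : ∀ x : ZMod 2, x ≠ 0 → x = 1 := by decide
  exact this _ hi

lemma sum_v (p : V) : ∑ g : V, v (g ⬝ᵥ p) = if p = 0 then 0 else 8192 := by
  split_ifs with h
  · subst h; simp [v]
  · obtain ⟨e, he⟩ := exists_dot h
    have h1 : ∑ g : V, v (g ⬝ᵥ p) = ∑ g : V, (1 - v (g ⬝ᵥ p)) := by
      rw [← Equiv.sum_comp (Equiv.addRight e)]
      refine Finset.sum_congr rfl fun g _ => ?_
      simp only [Equiv.coe_addRight, add_dotProduct, he, v_flip]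
    rw [Finset.sum_sub_distrib] at h1
    have h2 : ∑ g : V, (1:ℤ) = 16384 := by
      rw [Finset.sum_const, Finset.card_univ, cardV]; rfl
    rw [h2] at h1
    linarith

/-- weight -/
def w (m : V → ℤ) (g : V) : ℤ := ∑ p, m p * v (g ⬝ᵥ p)
def tot (m : V → ℤ) : ℤ := ∑ p, m p
def res (m : V → ℤ) (a : V) (p : V) : ℤ := if a ⬝ᵥ p = 0 then m p else 0

lemma w_res (m : V → ℤ) (a g : V) : 2 * w (res m a) g = w m g + w m (a + g) - w m a := by
  simp only [w, Finset.mul_sum, ← Finset.sum_add_distrib, ← Finset.sum_sub_distrib]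
  refine Finset.sum_congr rfl fun p _ => ?_
  have := v_res (a ⬝ᵥ p) (g ⬝ᵥ p)
  rw [add_dotProduct]
  simp only [res]
  split_ifs with h
  · rw [if_pos h] at this
    linear_combination m p * this
  · rw [if_neg h] at this
    linear_combination m p * this

lemma tot_res (m : V → ℤ) (a : V) : tot (res m a) = tot m - w m a := by
  simp only [w, tot, ← Finset.sum_sub_distrib]
  refine Finset.sum_congr rfl fun p _ => ?_
  have := v_res1 (a ⬝ᵥ p)
  simp only [res]
  split_ifs with h
  · rw [if_pos h] at this
    linear_combination m p * this
  · rw [if_neg h] at this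
    linear_combination m p * this

lemma dvd_res {m : V → ℤ} {d : ℤ} (h : ∀ g, 2 * d ∣ w m g) (a g : V) : d ∣ w (res m a) g := by
  have h1 := w_res m a g
  have h2 : 2 * d ∣ 2 * w (res m a) g := by
    rw [h1]; exact dvd_sub (dvd_add (h _) (h _)) (h _)
  exact (mul_dvd_mul_iff_left (by norm_num)).1 h2

lemma w_zero (m : V → ℤ) : w m 0 = 0 := by simp [w, v]

lemma mom1 {m : V → ℤ} (h0 : m 0 = 0) : ∑ g, w m g = 8192 * tot m := by
  simp only [w, tot]
  rw [Finset.sum_comm, Finset.mul_sum]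
  refine Finset.sum_congr rfl fun p _ => ?_
  rw [← Finset.mul_sum, sum_v]
  split_ifs with h
  · rw [h, h0]; simp
  · ring

lemma add_eq_zero_iff' (p q : V) : p + q = 0 ↔ q = p := by
  constructor
  · intro h
    have : p + (p + q) = p := by rw [h, add_zero]
    rw [← add_assoc, add_self, zero_add] at this; exact this
  · rintro rfl; exact add_self q

lemma pair (p q : V) (hp : p ≠ 0) (hq : q ≠ 0) : 2 * ∑ g : V, v (g ⬝ᵥ p) * v (g ⬝ᵥ q) =
    8192 + (if q = p then 8192 else 0) := by
  rw [Finset.mul_sum]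
  simp only [v_two, ← dotProduct_add]
  rw [Finset.sum_sub_distrib, Finset.sum_add_distrib, sum_v, sum_v, sum_v]
  simp only [hp, hq, add_eq_zero_iff', if_false]
  split_ifs <;> norm_num

lemma triple (p q r : V) (hp : p ≠ 0) (hq : q ≠ 0) (hr : r ≠ 0) :
    4 * ∑ g : V, v (g ⬝ᵥ p) * v (g ⬝ᵥ q) * v (g ⬝ᵥ r) ≤
    8192 + (if q = p then 8192 else 0) + (if r = p then 8192 else 0) + 
      (if r = q then 8192 else 0) := by
  rw [Finset.mul_sum]
  simp only [v_three, ← dotProduct_add]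
  rw [Finset.sum_add_distrib, Finset.sum_sub_distrib, Finset.sum_sub_distrib,
    Finset.sum_sub_distrib, Finset.sum_add_distrib, Finset.sum_add_distrib]
  simp only [sum_v]
  simp only [hp, hq, hr, add_eq_zero_iff' p q, add_eq_zero_iff' p r, add_eq_zero_iff' q r, if_false]
  split_ifs <;> norm_num

/-- a set of nonzero points -/
structure IsSet (m : V → ℤ) : Prop where
  zero : m 0 = 0
  bin : ∀ p, m p = 0 ∨ m p = 1

lemma IsSet.res {m : V → ℤ} (h : IsSet m) (a : V) : IsSet (res m a) := by
  constructor
  · simp only [CDC.res]; split_ifs <;> simp [h.zero]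
  · intro p; simp only [CDC.res]; split_ifs
    · exact h.bin p
    · exact Or.inl rfl

lemma IsSet.nonneg {m : V → ℤ} (h : IsSet m) (p : V) : 0 ≤ m p := by
  rcases h.bin p with h | h <;> simp [h]

lemma IsSet.ne {m : V → ℤ} (h : IsSet m) {p : V} (hp : p = 0) : m p = 0 := by
  rw [hp, h.zero]

lemma IsSet.sq {m : V → ℤ} (h : IsSet m) (p : V) : m p * m p = m p := by
  rcases h.bin p with h | h <;> simp [h]

lemma mom2 {m : V → ℤ} (h : IsSet m) : ∑ g, w m g ^ 2 = 4096 * (tot m * (tot m + 1)) := by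
  have h1 : ∀ g, w m g ^ 2 = ∑ p, ∑ q, m p * m q * (v (g ⬝ᵥ p) * v (g ⬝ᵥ q)) := by
    intro g
    rw [sq, w, Finset.sum_mul_sum]
    refine Finset.sum_congr rfl fun p _ => Finset.sum_congr rfl fun q _ => by ring
  have h2 : ∑ g, w m g ^ 2 = ∑ p, ∑ q, m p * m q * ∑ g : V, (v (g ⬝ᵥ p) * v (g ⬝ᵥ q)) := by
    simp only [h1, Finset.mul_sum]
    rw [Finset.sum_comm]
    refine Finset.sum_congr rfl fun p _ => ?_
    rw [Finset.sum_comm]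
  have h3 : 2 * ∑ g, w m g ^ 2 = ∑ p, ∑ q, (8192 * (m p * m q) + 
      (if q = p then 8192 * (m p * m q) else 0)) := by
    rw [h2, Finset.mul_sum]
    refine Finset.sum_congr rfl fun p _ => ?_
    rw [Finset.mul_sum]
    refine Finset.sum_congr rfl fun q _ => ?_
    by_cases hp : p = 0
    · simp [h.ne hp]
    by_cases hq : q = 0
    · simp [h.ne hq]
    have := pair p q hp hq
    split_ifs at this ⊢
    · linear_combination m p * m q * this
    · linear_combination m p * m q * this
  have h4 : ∑ p, ∑ q, (8192 * (m p * m q) + 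
      (if q = p then 8192 * (m p * m q) else 0)) = 8192 * (tot m * tot m) + 8192 * tot m := by
    simp only [Finset.sum_add_distrib, Finset.sum_ite_eq', Finset.mem_univ, if_true, h.sq,
      ← Finset.mul_sum, ← Finset.sum_mul, tot]
  linarith

lemma mom3 {m : V → ℤ} (h : IsSet m) :
    ∑ g, w m g ^ 3 ≤ 2048 * (tot m * tot m * (tot m + 3)) := by
  have h1 : ∀ g, w m g ^ 3 = ∑ p, ∑ q, ∑ r, m p * m q * m r *
      (v (g ⬝ᵥ p) * v (g ⬝ᵥ q) * v (g ⬝ᵥ r)) := by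
    intro g
    rw [pow_succ, sq, w, Finset.sum_mul_sum, Finset.sum_mul]
    refine Finset.sum_congr rfl fun p _ => ?_
    rw [Finset.sum_mul_sum]
    refine Finset.sum_congr rfl fun q _ => Finset.sum_congr rfl fun r _ => by ring
  have h2 : ∑ g, w m g ^ 3 = ∑ p, ∑ q, ∑ r, m p * m q * m r *
      ∑ g : V, (v (g ⬝ᵥ p) * v (g ⬝ᵥ q) * v (g ⬝ᵥ r)) := by
    simp only [h1, Finset.mul_sum]
    rw [Finset.sum_comm]
    refine Finset.sum_congr rfl fun p _ => ?_
    rw [Finset.sum_comm]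
    refine Finset.sum_congr rfl fun q _ => ?_
    rw [Finset.sum_comm]
  have h3 : 4 * ∑ g, w m g ^ 3 ≤ ∑ p, ∑ q, ∑ r, (8192 * (m p * m q * m r) + 
      (if q = p then 8192 * (m p * m q * m r) else 0) +
      (if r = p then 8192 * (m p * m q * m r) else 0) +
      (if r = q then 8192 * (m p * m q * m r) else 0)) := by
    rw [h2, Finset.mul_sum]
    refine Finset.sum_le_sum fun p _ => ?_
    rw [Finset.mul_sum]
    refine Finset.sum_le_sum fun q _ => ?_
    rw [Finset.mul_sum]
    refine Finset.sum_le_sum fun r _ => ?_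
    by_cases hp : p = 0
    · simp [h.ne hp]
    by_cases hq : q = 0
    · simp [h.ne hq]
    by_cases hr : r = 0
    · simp [h.ne hr]
    have := mul_le_mul_of_nonneg_left (triple p q r hp hq hr) 
      (mul_nonneg (mul_nonneg (h.nonneg p) (h.nonneg q)) (h.nonneg r))
    refine le_trans (le_of_eq (by ring)) (this.trans (le_of_eq ?_))
    simp only [mul_add, mul_ite, mul_zero]
    simp only [mul_comm (8192:ℤ)]
  have h4 : ∑ p, ∑ q, ∑ r, (8192 * (m p * m q * m r) + 
      (if q = p then 8192 * (m p * m q * m r) else 0) +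
      (if r = p then 8192 * (m p * m q * m r) else 0) +
      (if r = q then 8192 * (m p * m q * m r) else 0)) = 
      8192 * (tot m * tot m * tot m) + 3 * (8192 * (tot m * tot m)) := by
    have e1 : ∑ p, ∑ q, ∑ r, 8192 * (m p * m q * m r) = 8192 * (tot m * tot m * tot m) := by
      simp only [← Finset.mul_sum, ← Finset.sum_mul, tot]
    have e2 : ∑ p, ∑ q, ∑ r, (if q = p then 8192 * (m p * m q * m r) else 0) = 
        8192 * (tot m * tot m) := by
      have : ∀ p q, ∑ r, (if q = p then 8192 * (m p * m q * m r) else 0) = 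
        if q = p then 8192 * (m p * m q * tot m) else 0 := by
        intro p q
        split_ifs
        · simp only [← Finset.mul_sum, tot]
        · simp
      simp only [this, Finset.sum_ite_eq', Finset.mem_univ, if_true, h.sq,
        ← Finset.mul_sum, ← Finset.sum_mul]
      simp only [tot]
    have e3 : ∑ p, ∑ q, ∑ r, (if r = p then 8192 * (m p * m q * m r) else 0) = 
        8192 * (tot m * tot m) := by
      simp only [Finset.sum_ite_eq', Finset.mem_univ, if_true]
      simp only [mul_right_comm (m _) (m _) (m _), h.sq,
        ← Finset.mul_sum, ← Finset.sum_mul]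
      simp only [tot]
    have e4 : ∑ p, ∑ q, ∑ r, (if r = q then 8192 * (m p * m q * m r) else 0) = 
        8192 * (tot m * tot m) := by
      simp only [Finset.sum_ite_eq', Finset.mem_univ, if_true]
      simp only [mul_assoc (m _) (m _) (m _), h.sq,
        ← Finset.mul_sum, ← Finset.sum_mul]
      simp only [tot]
    simp only [Finset.sum_add_distrib, e1, e2, e3, e4]
    ring
  linarith

lemma w_nonneg {m : V → ℤ} (h : ∀ p, 0 ≤ m p) (g : V) : 0 ≤ w m g :=
  Finset.sum_nonneg fun p _ => mul_nonneg (h p) (v_nonneg _)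

lemma w_le {m : V → ℤ} (h : ∀ p, 0 ≤ m p) (g : V) : w m g ≤ tot m :=
  Finset.sum_le_sum fun p _ => by
    have := mul_le_mul_of_nonneg_left (v_le (g ⬝ᵥ p)) (h p)
    linarith

/-- number of words of weight t -/
def A (m : V → ℤ) (t : ℤ) : ℤ := ((univ.filter fun g => w m g = t).card : ℤ)

lemma sum_F {m : V → ℤ} (T : Finset ℤ) (hT : ∀ g, w m g ∈ T) (F : ℤ → ℤ) :
    ∑ g, F (w m g) = ∑ t ∈ T, A m t * F t := by
  rw [← Finset.sum_fiberwise_of_maps_to (t := T) (g := w m) (fun g _ => hT g)]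
  refine Finset.sum_congr rfl fun t _ => ?_
  rw [Finset.sum_congr rfl (g := fun _ => F t)]
  · simp [A]
  · intro g hg; rw [(Finset.mem_filter.1 hg).2]

lemma A_nonneg (m : V → ℤ) (t : ℤ) : 0 ≤ A m t := by simp [A]

lemma big {m : V → ℤ} (h0 : m 0 = 0) (c : ℤ) (hc : 2 * c < tot m) : ∃ g, c < w m g := by
  by_contra! hcon
  have h1 := mom1 h0
  have h2 : ∑ g, w m g ≤ ∑ g : V, c := Finset.sum_le_sum fun g _ => hcon g
  rw [Finset.sum_const, Finset.card_univ, cardV] at h2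
  simp at h2
  linarith

end CDC
namespace CDC
open Finset

lemma mom0 : ∑ _g : V, (1:ℤ) = 16384 := by
  rw [Finset.sum_const, Finset.card_univ, cardV]; rfl

lemma small {m : V → ℤ} (h0 : m 0 = 0) (hm : ∀ p, 0 ≤ m p) {d : ℤ} (hd : ∀ g, d ∣ w m g)
    (h1 : 0 < tot m) (h2 : tot m < d) : False := by
  obtain ⟨g, hg⟩ := big h0 0 (by linarith)
  have := Int.le_of_dvd hg (hd g)
  have := w_le hm g
  linarith

lemma e4_11 {m : V → ℤ} (h : IsSet m) (hd : ∀ g, 4 ∣ w m g) (ht : tot m = 11) : False := by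
  have h1 := mom1 h.zero
  have h2 := mom2 h
  have h3 : 0 ≤ ∑ g, (w m g ^ 2 - 12 * w m g + 32 * 1) := by
    refine Finset.sum_nonneg fun g _ => ?_
    obtain ⟨k, hk⟩ := hd g
    have a1 := w_nonneg h.nonneg g
    have a2 := w_le h.nonneg g
    have : k = 0 ∨ k = 1 ∨ k = 2 := by omega
    rcases this with rfl | rfl | rfl <;> rw [hk] <;> norm_num
  rw [Finset.sum_add_distrib, Finset.sum_sub_distrib, ← Finset.mul_sum, ← Finset.mul_sum, mom0,
    h1, h2, ht] at h3
  norm_num at h3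

/-- in a `2d`-divisible set, the complement of a word is not exceptional -/
lemma ex4 {m : V → ℤ} (h : IsSet m) (hd : ∀ g, 8 ∣ w m g) (g : V) :
    tot m - w m g ≠ 11 ∧ tot m - w m g ≠ 3 := by
  have h1 : ∀ x, (4:ℤ) ∣ w (res m g) x := fun x => dvd_res (by simpa using hd) g x
  constructor
  · intro h2; exact e4_11 (h.res g) h1 (by rw [tot_res, h2])
  · intro h2; exact small (h.res g).zero (h.res g).nonneg h1 (by rw [tot_res, h2]; norm_num)
      (by rw [tot_res, h2]; norm_num)

lemma e8_35 {m : V → ℤ} (h : IsSet m) (hd : ∀ g, 8 ∣ w m g) (ht : tot m = 35) : False := by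
  obtain ⟨g, hg⟩ := big h.zero 17 (by rw [ht]; norm_num)
  obtain ⟨h1, h2⟩ := ex4 h hd g
  have := w_le h.nonneg g
  obtain ⟨k, hk⟩ := hd g
  omega

lemma e8_19 {m : V → ℤ} (h : IsSet m) (hd : ∀ g, 8 ∣ w m g) (ht : tot m = 19) : False := by
  obtain ⟨g, hg⟩ := big h.zero 9 (by rw [ht]; norm_num)
  obtain ⟨h1, h2⟩ := ex4 h hd g
  have := w_le h.nonneg g
  obtain ⟨k, hk⟩ := hd g
  omega

lemma ex8 {m : V → ℤ} (h : IsSet m) (hd : ∀ g, 16 ∣ w m g) (g : V) :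
    tot m - w m g ≠ 35 ∧ tot m - w m g ≠ 19 ∧ tot m - w m g ≠ 3 := by
  have h1 : ∀ x, (8:ℤ) ∣ w (res m g) x := fun x => dvd_res (by simpa using hd) g x
  refine ⟨fun h2 => ?_, fun h2 => ?_, fun h2 => ?_⟩
  · exact e8_35 (h.res g) h1 (by rw [tot_res, h2])
  · exact e8_19 (h.res g) h1 (by rw [tot_res, h2])
  · exact small (h.res g).zero (h.res g).nonneg h1 (by rw [tot_res, h2]; norm_num)
      (by rw [tot_res, h2]; norm_num)

lemma v_add_le (x y : ZMod 2) : v (x + y) ≤ v x + v y := by revert x y; decide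

lemma w_add_le {m : V → ℤ} (h : ∀ p, 0 ≤ m p) (g k : V) : w m (g + k) ≤ w m g + w m k := by
  simp only [w, ← Finset.sum_add_distrib]
  refine Finset.sum_le_sum fun p _ => ?_
  rw [add_dotProduct, ← mul_add]
  exact mul_le_mul_of_nonneg_left (v_add_le _ _) (h p)

lemma add_add_self (g k : V) : g + k + k = g := by rw [add_assoc, add_self, add_zero]

lemma w_add_ker {m : V → ℤ} (h : ∀ p, 0 ≤ m p) (g : V) {k : V} (hk : w m k = 0) :
    w m (g + k) = w m g := by
  have h1 := w_add_le h g k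
  have h2 := w_add_le h (g + k) k
  rw [add_add_self] at h2
  linarith

def grp (H : Finset V) (h0 : 0 ∈ H) (ha : ∀ x ∈ H, ∀ y ∈ H, x + y ∈ H) : AddSubgroup V where
  carrier := H
  zero_mem' := h0
  add_mem' := fun {a b} hx hy => ha a hx b hy
  neg_mem' := fun {x} hx => by
    have : -x = x := neg_eq_of_add_eq_zero_left (add_self x)
    rw [this]; exact hx

lemma grp_card (H : Finset V) (h0 : 0 ∈ H) (ha : ∀ x ∈ H, ∀ y ∈ H, x + y ∈ H) :
    H.card ∣ 16384 := by
  have := AddSubgroup.card_addSubgroup_dvd_card (grp H h0 ha)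
  rw [Nat.card_eq_fintype_card (α := V), cardV] at this
  have e : Nat.card (grp H h0 ha) = H.card := by
    change Nat.card (H : Set V) = _
    simp
  rwa [e] at this

lemma coset_dvd (H : Finset V) (h0 : 0 ∈ H) (ha : ∀ x ∈ H, ∀ y ∈ H, x + y ∈ H)
    (Y : Finset V) (hY : ∀ y ∈ Y, ∀ x ∈ H, y + x ∈ Y) : H.card ∣ Y.card := by
  classical
  let G := grp H h0 ha
  let f : V → V ⧸ G := fun y => (y : V ⧸ G)
  rw [Finset.card_eq_sum_card_image f Y]
  refine Finset.dvd_sum fun b hb => ?_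
  obtain ⟨y, hy, rfl⟩ := Finset.mem_image.1 hb
  have : (Y.filter fun x => f x = f y) = H.image (fun x => y + x) := by
    ext x
    simp only [Finset.mem_filter, Finset.mem_image]
    constructor
    · rintro ⟨hx, hxy⟩
      refine ⟨-y + x, ?_, by abel⟩
      exact (QuotientAddGroup.eq.1 hxy.symm : -y + x ∈ G)
    · rintro ⟨z, hz, rfl⟩
      refine ⟨hY y hy z hz, ?_⟩
      refine (QuotientAddGroup.eq.2 ?_).symm
      have : -y + (y + z) = z := by abel
      rw [this]; exact hz
  rw [this, Finset.card_image_of_injective _ (add_right_injective y)]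

def W (m : V → ℤ) (t : ℤ) : Finset V := univ.filter fun g => w m g = t

lemma mem_W {m : V → ℤ} {t : ℤ} {g : V} : g ∈ W m t ↔ w m g = t := by simp [W]
lemma A_eq (m : V → ℤ) (t : ℤ) : A m t = (W m t).card := rfl

lemma ker_zero (m : V → ℤ) : 0 ∈ W m 0 := by rw [mem_W, w_zero]
lemma ker_add {m : V → ℤ} (h : ∀ p, 0 ≤ m p) : ∀ x ∈ W m 0, ∀ y ∈ W m 0, x + y ∈ W m 0 := by
  intro x hx y hy
  rw [mem_W] at *
  rw [w_add_ker h x hy, hx]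

lemma ker_dvd {m : V → ℤ} (h : ∀ p, 0 ≤ m p) (t : ℤ) : A m 0 ∣ A m t := by
  rw [A_eq, A_eq]
  refine Int.natCast_dvd_natCast.2 (coset_dvd _ (ker_zero m) (ker_add h) _ ?_)
  intro y hy x hx
  rw [mem_W] at *
  rw [w_add_ker h y hx, hy]

lemma A_pos {m : V → ℤ} {t : ℤ} {g : V} (h : w m g = t) : 0 < A m t := by
  rw [A_eq]; exact_mod_cast Finset.card_pos.2 ⟨g, mem_W.2 h⟩

lemma A_zero {m : V → ℤ} {t : ℤ} (h : A m t = 0) (g : V) : w m g ≠ t := by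
  intro hg; have := A_pos hg; omega

lemma A_ex {m : V → ℤ} {t : ℤ} (h : 0 < A m t) : ∃ g, w m g = t := by
  rw [A_eq] at h
  obtain ⟨g, hg⟩ := Finset.card_pos.1 (by exact_mod_cast h : 0 < (W m t).card)
  exact ⟨g, mem_W.1 hg⟩

lemma pow_dvd {k : ℤ} (h1 : 30 ≤ k) (h2 : k ≤ 64) (h : k ∣ 16384) : k = 32 ∨ k = 64 := by
  interval_cases k <;> omega

lemma l51 {m : V → ℤ} (h : IsSet m) (hd : ∀ g, 8 ∣ w m g) (ht : tot m = 51) :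
    (∀ g, w m g = 0 ∨ w m g = 24 ∨ w m g = 32) ∧ A m 0 = 64 ∧ A m 32 = 51 * 64 := by
  have hT : ∀ g, w m g ∈ ({0, 8, 16, 24, 32} : Finset ℤ) := by
    intro g
    obtain ⟨h1, h2⟩ := ex4 h hd g
    have := w_le h.nonneg g
    have := w_nonneg h.nonneg g
    obtain ⟨k, hk⟩ := hd g
    simp only [Finset.mem_insert, Finset.mem_singleton]
    omega
  have m0 := mom0
  have m1 := mom1 h.zero
  have m2 := mom2 h
  have m3 := mom3 h
  rw [sum_F _ hT (fun _ => 1)] at m0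
  rw [sum_F _ hT (fun x => x)] at m1
  rw [sum_F _ hT (fun x => x ^ 2)] at m2
  rw [sum_F _ hT (fun x => x ^ 3)] at m3
  rw [ht] at m1 m2 m3
  norm_num at m0 m1 m2 m3
  have p8 := A_nonneg m 8
  have p16 := A_nonneg m 16
  have d0 : A m 0 ∣ 16384 := by
    rw [A_eq]
    exact_mod_cast grp_card _ (ker_zero m) (ker_add h.nonneg)
  have d16 := ker_dvd h.nonneg 16
  have hk := pow_dvd (k := A m 0) (by linarith) (by linarith) d0
  have hk64 : A m 0 = 64 := by
    rcases hk with hk | hk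
    · exfalso
      rw [hk] at m0 d16
      have z16 : A m 16 = 0 := by omega
      have z8 : A m 8 = 64 := by omega
      have := grp_card (W m 0 ∪ W m 8) (Finset.mem_union_left _ (ker_zero m)) (by
        intro x hx y hy
        simp only [Finset.mem_union, mem_W] at *
        have a1 := w_add_le h.nonneg x y
        have a2 := hT (x + y)
        have a3 := A_zero z16 (x + y)
        simp only [Finset.mem_insert, Finset.mem_singleton] at a2
        omega)
      rw [Finset.card_union_of_disjoint] at this
      · have e0 : (W m 0).card = 32 := by rw [A_eq] at hk; exact_mod_cast hk
        have e8 : (W m 8).card = 64 := by rw [A_eq] at z8; exact_mod_cast z8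
        rw [e0, e8] at this
        revert this; decide
      · rw [Finset.disjoint_left]
        intro x hx hy
        rw [mem_W] at hx hy
        omega
    · exact hk
  have z8 : A m 8 = 0 := by linarith
  have z16 : A m 16 = 0 := by linarith
  refine ⟨fun g => ?_, hk64, by linarith⟩
  have a := hT g
  have a1 := A_zero z8 g
  have a2 := A_zero z16 g
  simp only [Finset.mem_insert, Finset.mem_singleton] at a
  omega

end CDC
namespace CDC
open Finset

lemma l131 {m : V → ℤ} (h : IsSet m) (hd : ∀ g, 16 ∣ w m g) (ht : tot m = 131) : False := by
  have hT : ∀ g, w m g ∈ ({0, 16, 32, 48, 64, 80} : Finset ℤ) := by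
    intro g
    obtain ⟨h1, h2, h3⟩ := ex8 h hd g
    have := w_le h.nonneg g
    have := w_nonneg h.nonneg g
    obtain ⟨k, hk⟩ := hd g
    simp only [Finset.mem_insert, Finset.mem_singleton]
    omega
  have hT' : ∀ g, w m g = 0 ∨ w m g = 16 ∨ w m g = 32 ∨ w m g = 48 ∨ w m g = 64 ∨ w m g = 80 := by
    intro g
    simpa only [Finset.mem_insert, Finset.mem_singleton] using hT g
  have m0 := mom0
  have m1 := mom1 h.zero
  have m2 := mom2 h
  rw [sum_F _ hT (fun _ => 1)] at m0
  rw [sum_F _ hT (fun x => x)] at m1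
  rw [sum_F _ hT (fun x => x ^ 2)] at m2
  rw [ht] at m1 m2
  norm_num at m0 m1 m2
  -- residuals
  have hr8 : ∀ a x, (8:ℤ) ∣ w (res m a) x := fun a x => dvd_res (by simpa using hd) a x
  have h51 : ∀ a, w m a = 80 → _ := fun a ha =>
    l51 (h.res a) (hr8 a) (by rw [tot_res, ha, ht]; norm_num)
  have hsum : ∀ a, w m a = 80 → ∀ g, w m g + w m (a + g) = 80 ∨ w m g + w m (a + g) = 128 ∨
      w m g + w m (a + g) = 144 := by
    intro a ha g
    have h1 := (h51 a ha).1 g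
    have h2 := w_res m a g
    omega
  obtain ⟨a, ha'⟩ := big h.zero 65 (by rw [ht]; norm_num)
  have ha : w m a = 80 := by have := hT' a; omega
  -- low words
  have hlow : ∀ x, w m x = 80 → ∀ c, w m c ≤ 32 → w m c + w m (x + c) = 80 := by
    intro x hx c hc
    have h1 := hsum x hx c
    have h2 := hT' (x + c)
    omega
  have hL : A m 0 + A m 16 + A m 32 = 32 := by
    have h1 := (h51 a ha).2.1
    let L : Finset V := univ.filter fun g => w m g ≤ 32
    have hLc : (L.card : ℤ) = A m 0 + A m 16 + A m 32 := by
      have : L = W m 0 ∪ W m 16 ∪ W m 32 := by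
        ext g
        have := hT' g
        simp only [L, Finset.mem_filter, Finset.mem_univ, true_and, Finset.mem_union, mem_W]
        omega
      rw [this, Finset.card_union_of_disjoint, Finset.card_union_of_disjoint, A_eq, A_eq, A_eq]
      · push_cast; ring
      · rw [Finset.disjoint_left]
        intro x hx hy
        rw [mem_W] at hx hy
        omega
      · rw [Finset.disjoint_left]
        intro x hx hy
        simp only [Finset.mem_union, mem_W] at hx hy
        omega
    have hD : W (res m a) 0 = L ∪ L.image (fun x => a + x) := by
      ext g
      simp only [L, Finset.mem_filter, Finset.mem_univ, true_and, Finset.mem_union, mem_W,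
        Finset.mem_image]
      have e := w_res m a g
      constructor
      · intro hg
        by_cases hg2 : w m g ≤ 32
        · exact Or.inl hg2
        · right
          refine ⟨a + g, ?_, by rw [← add_assoc, add_self, zero_add]⟩
          have := hT' g
          have := hT' (a + g)
          omega
      · rintro (hg | ⟨x, hx, rfl⟩)
        · have := hlow a ha g hg
          omega
        · have := hlow a ha x hx
          rw [← add_assoc, add_self, zero_add] at e
          omega
    have hdis : Disjoint L (L.image (fun x => a + x)) := by
      rw [Finset.disjoint_left]
      intro x hx hy0
      obtain ⟨y, hy, rfl⟩ := Finset.mem_image.1 hy0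
      simp only [L, Finset.mem_filter, Finset.mem_univ, true_and] at hx hy
      have := hlow a ha y hy
      omega
    rw [A_eq, hD, Finset.card_union_of_disjoint hdis,
      Finset.card_image_of_injective _ (add_right_injective a)] at h1
    push_cast at h1
    linarith
  -- the word b
  obtain ⟨b, hb, hab⟩ : ∃ b, w m b = 64 ∧ w m (a + b) = 80 := by
    obtain ⟨b, hb⟩ := A_ex (m := res m a) (t := 32) (by rw [(h51 a ha).2.2]; norm_num)
    have e := w_res m a b
    rcases hT' b with h1 | h1 | h1 | h1 | h1 | h1 <;>
    rcases hT' (a + b) with h2 | h2 | h2 | h2 | h2 | h2 <;> try omega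
    · exact ⟨b, h1, h2⟩
    · exact ⟨a + b, h2, by rw [← add_assoc, add_self, zero_add]; exact h1⟩
  have hbc : ∀ c, w m c ≤ 32 → w m (b + c) = 64 + w m c := by
    intro c hc
    have h1 := hlow a ha c hc
    have h2 := hlow (a + b) hab c hc
    have e1 := w_res m a c
    have e2 := w_res m a (b + c)
    have e3 : w (res m a) c = 0 := by omega
    have e4 := w_add_ker (h.res a).nonneg b e3
    have e5 := w_res m a b
    rw [← add_assoc] at e2
    linarith
  have z32 : ∀ c, w m c ≠ 32 := by
    intro c hc
    have := hbc c (by omega)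
    have := hT' (b + c)
    omega
  have A32 : A m 32 = 0 := by
    by_contra hne
    obtain ⟨c, hc⟩ := A_ex (m := m) (t := 32) (by have := A_nonneg m 32; omega)
    exact z32 c hc
  have hcc : ∀ c c', w m c = 16 → w m c' = 16 → w m (c + c') = 0 := by
    intro c c' hc hc'
    have h1 := hbc c (by omega)
    have h2 := hlow (b + c) (by omega) c' (by omega)
    have h3 := w_add_le h.nonneg c c'
    have h4 := hbc (c + c') (by omega)
    rw [← add_assoc] at h4
    linarith
  have hA16 : A m 16 = 0 ∨ A m 16 = A m 0 := by
    by_cases hz : A m 16 = 0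
    · exact Or.inl hz
    right
    obtain ⟨c, hc⟩ := A_ex (m := m) (t := 16) (by have := A_nonneg m 16; omega)
    have : W m 16 = (W m 0).image (fun x => c + x) := by
      ext g
      simp only [mem_W, Finset.mem_image]
      constructor
      · intro hg
        exact ⟨c + g, hcc c g hc hg, by rw [← add_assoc, add_self, zero_add]⟩
      · rintro ⟨x, hx, rfl⟩
        rw [w_add_ker h.nonneg c hx, hc]
    rw [A_eq, A_eq, this, Finset.card_image_of_injective _ (add_right_injective c)]
  have h48 : 0 < A m 48 := by
    rcases hA16 with h1 | h1 <;> omega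
  obtain ⟨f, hf⟩ := A_ex h48
  have hf80 : ∀ x, w m x = 80 → w m (x + f) = 80 := by
    intro x hx
    have h1 := hsum x hx f
    have h2 := hT' (x + f)
    have h3 := z32 (x + f)
    omega
  let H : Finset V := W m 0 ∪ (W m 0).image (fun x => f + x)
  have hmem : ∀ x, x ∈ H ↔ w m x = 0 ∨ w m (f + x) = 0 := by
    intro x
    simp only [H, Finset.mem_union, mem_W, Finset.mem_image]
    constructor
    · rintro (hx | ⟨y, hy, rfl⟩)
      · exact Or.inl hx
      · right; rw [← add_assoc, add_self, zero_add]; exact hy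
    · rintro (hx | hx)
      · exact Or.inl hx
      · right; exact ⟨f + x, hx, by rw [← add_assoc, add_self, zero_add]⟩
  have hHc : (H.card : ℤ) = 2 * A m 0 := by
    have hdis : Disjoint (W m 0) ((W m 0).image (fun x => f + x)) := by
      rw [Finset.disjoint_left]
      intro x hx hy0
      obtain ⟨y, hy, rfl⟩ := Finset.mem_image.1 hy0
      rw [mem_W] at hx hy
      rw [w_add_ker h.nonneg f hy] at hx
      omega
    rw [Finset.card_union_of_disjoint hdis,
      Finset.card_image_of_injective _ (add_right_injective f), A_eq]
    push_cast; ring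
  have hdvd := coset_dvd H (Finset.mem_union_left _ (ker_zero m)) (by
    intro x hx y hy
    rw [hmem] at *
    rcases hx with hx | hx <;> rcases hy with hy | hy
    · left; rw [w_add_ker h.nonneg x hy, hx]
    · right
      have : f + (x + y) = (f + y) + x := by abel
      rw [this, w_add_ker h.nonneg _ hx, hy]
    · right
      rw [← add_assoc, w_add_ker h.nonneg _ hy, hx]
    · left
      have : x + y = (f + x) + (f + y) := by
        have e : (f + x) + (f + y) = (f + f) + (x + y) := by abel
        rw [e, add_self, zero_add]
      rw [this, w_add_ker h.nonneg _ hy, hx]) (W m 80) (by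
    intro y hy x hx
    rw [hmem] at hx
    rw [mem_W] at *
    rcases hx with hx | hx
    · rw [w_add_ker h.nonneg _ hx, hy]
    · have : y + x = (y + f) + (f + x) := by
        have e : (y + f) + (f + x) = (f + f) + (y + x) := by abel
        rw [e, add_self, zero_add]
      rw [this, w_add_ker h.nonneg _ hx, hf80 y hy])
  have hdvd' : 2 * A m 0 ∣ A m 80 := by
    rw [← hHc, A_eq]; exact Int.natCast_dvd_natCast.2 hdvd
  rcases hA16 with h1 | h1
  · have k0 : A m 0 = 32 := by omega
    have k80 : A m 80 = 1696 := by omega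
    rw [k0, k80] at hdvd'
    revert hdvd'; decide
  · have k0 : A m 0 = 16 := by omega
    have k80 : A m 80 = 1744 := by omega
    rw [k0, k80] at hdvd'
    revert hdvd'; decide

lemma l147 {m : V → ℤ} (h0 : m 0 = 0) (hm : ∀ p, 0 ≤ m p) (hd : ∀ g, 32 ∣ w m g)
    (ht : tot m = 147) : False := by
  have rz : ∀ {m : V → ℤ} (a : V), m 0 = 0 → res m a 0 = 0 := by
    intro m a h; simp only [res]; split_ifs <;> simp [h]
  have rn : ∀ {m : V → ℤ} (a : V), (∀ p, 0 ≤ m p) → ∀ p, 0 ≤ res m a p := by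
    intro m a h p; simp only [res]; split_ifs
    · exact h p
    · exact le_rfl
  have c8 : ∀ {m : V → ℤ}, m 0 = 0 → (∀ p, 0 ≤ m p) → (∀ g, 8 ∣ w m g) → tot m = 19 → False := by
    intro m h0 hm hd ht
    obtain ⟨g, hg⟩ := big h0 9 (by rw [ht]; norm_num)
    have h1 := w_le hm g
    have h2 := hd g
    have h3 : w m g = 16 := by omega
    have h4 : ∀ x, (4:ℤ) ∣ w (res m g) x := fun x => dvd_res (by simpa using hd) g x
    have h5 := tot_res m g
    exact small (rz g h0) (rn g hm) h4 (by omega) (by omega)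
  have c16 : ∀ {m : V → ℤ}, m 0 = 0 → (∀ p, 0 ≤ m p) → (∀ g, 16 ∣ w m g) →
      tot m = 19 ∨ tot m = 51 → False := by
    intro m h0 hm hd ht
    obtain ⟨g, hg⟩ : ∃ g, tot m - 3 = w m g ∨ tot m - 19 = w m g := by
      rcases ht with ht | ht
      · obtain ⟨g, hg⟩ := big h0 9 (by rw [ht]; norm_num)
        have h1 := w_le hm g
        have h2 := hd g
        exact ⟨g, by omega⟩
      · obtain ⟨g, hg⟩ := big h0 25 (by rw [ht]; norm_num)
        have h1 := w_le hm g
        have h2 := hd g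
        exact ⟨g, by omega⟩
    have h4 : ∀ x, (8:ℤ) ∣ w (res m g) x := fun x => dvd_res (by simpa using hd) g x
    have h5 := tot_res m g
    rcases hg with hg | hg
    · exact small (rz g h0) (rn g hm) h4 (by omega) (by omega)
    · exact c8 (rz g h0) (rn g hm) h4 (by omega)
  obtain ⟨g, hg⟩ := big h0 73 (by rw [ht]; norm_num)
  have h1 := w_le hm g
  have h2 := hd g
  have h4 : ∀ x, (16:ℤ) ∣ w (res m g) x := fun x => dvd_res (by simpa using hd) g x
  have h5 := tot_res m g
  exact c16 (rz g h0) (rn g hm) h4 (by omega)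

end CDC
namespace CDC
open Finset
open scoped Classical in
/-- indicator of a subspace -/
noncomputable def I (U : Submodule (ZMod 2) V) (x : V) : ℤ := if x ∈ U then 1 else 0

lemma sum_I {U : Submodule (ZMod 2) V} (hU : Module.finrank (ZMod 2) U = 6) :
    ∑ x, I U x = 64 := by
  classical
  have h := Module.natCard_eq_pow_finrank (K := ZMod 2) (V := U)
  rw [hU, Nat.card_zmod] at h
  have h2 : Nat.card U = (univ.filter fun x => x ∈ U).card := by
    rw [Nat.card_eq_fintype_card, Fintype.card_subtype]
  rw [h2] at h
  simp only [I, Finset.sum_boole]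
  rw [h]; norm_num

lemma w_I_one {U : Submodule (ZMod 2) V} (hU : Module.finrank (ZMod 2) U = 6) {g p : V}
    (hp : p ∈ U) (hg : g ⬝ᵥ p = 1) : w (I U) g = 32 := by
  have h1 : w (I U) g = ∑ x, (I U x - I U x * v (g ⬝ᵥ x)) := by
    rw [w, ← Equiv.sum_comp (Equiv.addRight p)]
    refine Finset.sum_congr rfl fun x _ => ?_
    simp only [Equiv.coe_addRight, dotProduct_add, hg, v_flip]
    have : I U (x + p) = I U x := by
      have e := Submodule.add_mem_iff_left U (x := x) hp
      unfold I
      by_cases hx : x ∈ U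
      · rw [if_pos hx, if_pos (e.2 hx)]
      · rw [if_neg hx, if_neg (fun h => hx (e.1 h))]
    rw [this]; ring
  rw [Finset.sum_sub_distrib, sum_I hU] at h1
  change _ = 64 - w (I U) g at h1
  linarith

lemma w_I_dvd {U : Submodule (ZMod 2) V} (hU : Module.finrank (ZMod 2) U = 6) (g : V) :
    32 ∣ w (I U) g := by
  by_cases h : ∃ p ∈ U, g ⬝ᵥ p = 1
  · obtain ⟨p, hp, hg⟩ := h
    rw [w_I_one hU hp hg]
  · push Not at h
    have : w (I U) g = 0 := by
      refine Finset.sum_eq_zero fun x _ => ?_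
      by_cases hx : x ∈ U
      · simp [v, h x hx]
      · simp [I, hx]
    rw [this]; exact dvd_zero _

noncomputable def M (c : ℤ) (T : Finset (Submodule (ZMod 2) V)) (x : V) : ℤ :=
  if x = 0 then 0 else c - ∑ U ∈ T, I U x

lemma w_M (c : ℤ) (T : Finset (Submodule (ZMod 2) V)) (g : V) :
    w (M c T) g = c * (if g = 0 then 0 else 8192) - ∑ U ∈ T, w (I U) g := by
  have h1 : ∀ x, M c T x * v (g ⬝ᵥ x) = c * v (g ⬝ᵥ x) - ∑ U ∈ T, I U x * v (g ⬝ᵥ x) := by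
    intro x
    simp only [M]
    split_ifs with hx
    · subst hx; simp [v]
    · rw [sub_mul, Finset.sum_mul]
  simp only [w, h1]
  rw [Finset.sum_sub_distrib, ← Finset.mul_sum, Finset.sum_comm, ← sum_v]
  simp only [dotProduct_comm g]

lemma tot_M (c : ℤ) (T : Finset (Submodule (ZMod 2) V))
    (hT : ∀ U ∈ T, Module.finrank (ZMod 2) U = 6) :
    tot (M c T) = c * 16383 - 63 * T.card := by
  have h1 : ∀ x, M c T x = (c - ∑ U ∈ T, I U x) - if x = 0 then c - (T.card : ℤ) else 0 := by
    intro x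
    simp only [M]
    split_ifs with hx
    · subst hx; simp [I]
    · ring
  simp only [tot, h1]
  rw [Finset.sum_sub_distrib, Finset.sum_sub_distrib, Finset.sum_comm,
    Finset.sum_congr rfl fun U hU => sum_I (hT U hU)]
  rw [Finset.sum_ite_eq' univ (0:V), Finset.sum_const, Finset.sum_const, Finset.card_univ, cardV]
  simp
  ring

lemma M_zero (c : ℤ) (T : Finset (Submodule (ZMod 2) V)) : M c T 0 = 0 := by simp [M]

lemma w_M_dvd (c : ℤ) (T : Finset (Submodule (ZMod 2) V))
    (hT : ∀ U ∈ T, Module.finrank (ZMod 2) U = 6) (g : V) : 32 ∣ w (M c T) g := by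
  rw [w_M]
  refine dvd_sub (dvd_mul_of_dvd_right ?_ _) (Finset.dvd_sum fun U hU => w_I_dvd (hT U hU) g)
  split_ifs <;> norm_num

open scoped Classical in
lemma deg_le (T : Finset (Submodule (ZMod 2) V))
    (hT : ∀ U ∈ T, Module.finrank (ZMod 2) U = 6)
    (hint : ∀ U ∈ T, ∀ W ∈ T, U ≠ W → ∀ x ∈ U, x ∈ W → ∀ y ∈ U, y ∈ W → x ≠ 0 → y ≠ 0 → x = y)
    (p : V) (hp : p ≠ 0) : (T.filter fun U => p ∈ U).card ≤ 259 := by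
  by_contra hcon
  obtain ⟨S, hS, hSc⟩ := Finset.exists_subset_card_eq (show 260 ≤ (T.filter fun U => p ∈ U).card by omega)
  have hS6 : ∀ U ∈ S, Module.finrank (ZMod 2) U = 6 := fun U hU => 
    hT U (Finset.mem_filter.1 (hS hU)).1
  have hSp : ∀ U ∈ S, p ∈ U := fun U hU => (Finset.mem_filter.1 (hS hU)).2
  obtain ⟨g, hg⟩ := exists_dot hp
  have hg0 : g ≠ 0 := by rintro rfl; simp at hg
  have hw : w (M 1 S) g = -128 := by
    rw [w_M, if_neg hg0, Finset.sum_congr rfl fun U hU => w_I_one (hS6 U hU) (hSp U hU) hg]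
    simp [hSc]
  refine l131 (m := res (M 1 S) g) ⟨?_, ?_⟩ 
    (fun x => dvd_res (by simpa using w_M_dvd 1 S hS6) g x) ?_
  · simp [res, M_zero]
  · intro x
    simp only [res]
    split_ifs with hx
    swap
    · exact Or.inl rfl
    by_cases h0 : x = 0
    · simp [h0, M_zero]
    simp only [M, if_neg h0]
    by_cases hex : ∃ U ∈ S, x ∈ U
    · obtain ⟨U, hU, hxU⟩ := hex
      left
      rw [Finset.sum_eq_single_of_mem U hU]
      · simp [I, hxU]
      · intro W hW hne
        simp only [I]
        rw [if_neg]
        intro hxW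
        have := hint U (Finset.mem_filter.1 (hS hU)).1 W (Finset.mem_filter.1 (hS hW)).1 hne.symm
          x hxU hxW p (hSp U hU) (hSp W hW) h0 hp
        rw [this, hg] at hx
        exact one_ne_zero hx
    · push Not at hex
      right
      rw [Finset.sum_eq_zero]
      · simp
      · intro U hU; simp [I, hex U hU]
  · rw [tot_res, tot_M _ _ hS6, hw, hSc]; norm_num

lemma inter_le {X : Submodule (ZMod 2) V} (hX : Module.finrank (ZMod 2) X ≤ 1) {x y : V}
    (hx : x ∈ X) (hy : y ∈ X) (hx0 : x ≠ 0) (hy0 : y ≠ 0) : x = y := by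
  obtain ⟨z, hz⟩ := finrank_le_one_iff.1 hX
  obtain ⟨c, hc⟩ := hz ⟨x, hx⟩
  obtain ⟨d, hd⟩ := hz ⟨y, hy⟩
  have hc' : c • (z : V) = x := congrArg Subtype.val hc
  have hd' : d • (z : V) = y := congrArg Subtype.val hd
  have h2 : ∀ x : ZMod 2, x = 0 ∨ x = 1 := by decide
  rcases h2 c with rfl | rfl
  · simp at hc'; exact absurd hc'.symm hx0
  rcases h2 d with rfl | rfl
  · simp at hd'; exact absurd hd'.symm hy0
  rw [← hc', ← hd']

end CDC

/-- `A₂(14, 10; 6) ≤ 67349`. -/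
theorem cdc_bound_14_10_6
    (𝒮 : Finset (Submodule (ZMod 2) (Fin 14 → ZMod 2)))
    (hdim : ∀ U ∈ 𝒮, Module.finrank (ZMod 2) U = 6)
    (hdist : ∀ U ∈ 𝒮, ∀ W ∈ 𝒮, U ≠ W →
      10 ≤ Module.finrank (ZMod 2) U + Module.finrank (ZMod 2) W
            - 2 * Module.finrank (ZMod 2) ↥(U ⊓ W)) :
    𝒮.card ≤ 67349 := by
  classical
  by_contra hcon
  obtain ⟨T, hT, hTc⟩ := Finset.exists_subset_card_eq (show 67350 ≤ 𝒮.card by omega)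
  have hT6 : ∀ U ∈ T, Module.finrank (ZMod 2) U = 6 := fun U hU => hdim U (hT hU)
  have hint : ∀ U ∈ T, ∀ W ∈ T, U ≠ W → ∀ x ∈ U, x ∈ W → ∀ y ∈ U, y ∈ W →
      x ≠ 0 → y ≠ 0 → x = y := by
    intro U hU W hW hne x hxU hxW y hyU hyW hx0 hy0
    have h1 := hdist U (hT hU) W (hT hW) hne
    rw [hT6 U hU, hT6 W hW] at h1
    have h2 : Module.finrank (ZMod 2) ↥(U ⊓ W) ≤ 1 := by omega
    exact CDC.inter_le (X := U ⊓ W) h2 ⟨hxU, hxW⟩ ⟨hyU, hyW⟩ hx0 hy0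
  refine CDC.l147 (CDC.M_zero 259 T) ?_ (CDC.w_M_dvd 259 T hT6) ?_
  · intro p
    simp only [CDC.M]
    split_ifs with hp
    · exact le_rfl
    · have h1 := CDC.deg_le T hT6 hint p hp
      simp only [CDC.I, Finset.sum_boole]
      have : ((T.filter fun U => p ∈ U).card : ℤ) ≤ 259 := by exact_mod_cast h1
      linarith
  · rw [CDC.tot_M _ _ hT6, hTc]; norm_num
end

section
/- If 𝒮 is a family of 7-dimensional linear subspaces of F₂^15 such that for all distinct U, W ∈ 𝒮 the subspace distance dim(U) + dim(W) − 2·dim(U ⊓ W) is at least 10, then the cardinality of 𝒮 is at most 17727975. Equivalently, A₂(15, 10; 7) ≤ 17727975. -/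
set_option linter.constructorNameAsVariable false

open Classical in
theorem aux_card (U : Submodule (ZMod 2) (Fin 15 → ZMod 2)) :
    (Finset.univ.filter (fun z => z ∈ U)).card = 2 ^ Module.finrank (ZMod 2) U := by
  have h := Module.natCard_eq_pow_finrank (K := ZMod 2) (V := U)
  rw [Nat.card_zmod] at h
  rw [← h, Nat.card_eq_fintype_card, Fintype.card_subtype]

open Classical in
theorem aux_pairs (U : Submodule (ZMod 2) (Fin 15 → ZMod 2))
    (hU : Module.finrank (ZMod 2) U = 7) :
    127 * 126 ≤ (Finset.univ.filter (fun p : Fin 2 → (Fin 15 → ZMod 2) =>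
      LinearIndependent (ZMod 2) p ∧ ∀ i, p i ∈ U)).card := by
  have h := card_linearIndependent (K := ZMod 2) (V := U) (k := 2) (by omega)
  rw [hU] at h
  simp only [Fin.prod_univ_two, ZMod.card] at h
  norm_num at h
  rw [← Fintype.card_subtype]
  refine le_trans (le_of_eq (by rw [h])) (Fintype.card_le_of_injective
    (fun (s : {s : Fin 2 → U // LinearIndependent (ZMod 2) s}) => ⟨fun i => (s.1 i : Fin 15 → ZMod 2), s.2.map' U.subtype (Submodule.ker_subtype U), fun i => (s.1 i).2⟩) ?_)
  · intro s t hst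
    apply Subtype.ext
    funext i
    apply Subtype.ext
    exact congrFun (congrArg Subtype.val hst) i

open Classical in
theorem aux_all : (Finset.univ.filter (fun p : Fin 2 → (Fin 15 → ZMod 2) =>
      LinearIndependent (ZMod 2) p)).card = 32767 * 32766 := by
  have h := card_linearIndependent (K := ZMod 2) (V := Fin 15 → ZMod 2) (k := 2) (by simp)
  simp only [Fin.prod_univ_two, ZMod.card, Module.finrank_fin_fun] at h
  norm_num at h
  rw [Fintype.card_subtype] at h
  rw [h]

open Classical in
theorem aux_diff (P U : Submodule (ZMod 2) (Fin 15 → ZMod 2)) (hPU : P ≤ U) :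
    (Finset.univ.filter (fun z => z ∈ U ∧ z ∉ P)).card =
      2 ^ Module.finrank (ZMod 2) U - 2 ^ Module.finrank (ZMod 2) P := by
  rw [← aux_card, ← aux_card, ← Finset.card_sdiff_of_subset]
  · congr 1
    ext z
    simp
  · intro z
    simpa using fun h => hPU h

/-- `A₂(15, 10; 7) ≤ 17727975`. -/
theorem cdc_bound_15_10_7
    (𝒮 : Finset (Submodule (ZMod 2) (Fin 15 → ZMod 2)))
    (hdim : ∀ U ∈ 𝒮, Module.finrank (ZMod 2) U = 7)
    (hdist : ∀ U ∈ 𝒮, ∀ W ∈ 𝒮, U ≠ W →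
      10 ≤ Module.finrank (ZMod 2) U + Module.finrank (ZMod 2) W
            - 2 * Module.finrank (ZMod 2) ↥(U ⊓ W)) :
    𝒮.card ≤ 17727975 := by
  classical
  have key := Finset.card_mul_le_card_mul (s := 𝒮)
    (t := Finset.univ.filter (fun p : Fin 2 → (Fin 15 → ZMod 2) => LinearIndependent (ZMod 2) p))
    (fun U p => ∀ i, p i ∈ U) (m := 127 * 126) (n := 264) ?_ ?_
  · rw [aux_all] at key
    omega
  · intro U hU
    refine (aux_pairs U (hdim U hU)).trans (le_of_eq ?_)
    rw [Finset.bipartiteAbove, Finset.filter_filter]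
  · intro p hp
    rw [Finset.mem_filter] at hp
    have hp' := hp.2
    clear hp
    set P := Submodule.span (ZMod 2) (Set.range p) with hP
    have hPd : Module.finrank (ZMod 2) P = 2 := by
      simpa using finrank_span_eq_card hp'
    have hle : ∀ U ∈ 𝒮.filter (fun U => ∀ i, p i ∈ U), U ∈ 𝒮 ∧ P ≤ U := by
      intro U hU
      rw [Finset.mem_filter] at hU
      refine ⟨hU.1, Submodule.span_le.2 ?_⟩
      rintro _ ⟨i, rfl⟩
      exact hU.2 i
    have k2 := Finset.card_mul_le_card_mul (s := 𝒮.filter (fun U => ∀ i, p i ∈ U))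
      (t := Finset.univ.filter (fun z : Fin 15 → ZMod 2 => z ∉ P))
      (fun U z => z ∈ U) (m := 124) (n := 1) ?_ ?_
    · have h3 := aux_diff P ⊤ le_top
      simp only [Submodule.mem_top, true_and, finrank_top, hPd, Module.finrank_fin_fun] at h3
      rw [h3] at k2
      rw [Finset.bipartiteBelow]
      omega
    · intro U hU
      obtain ⟨h1, h2⟩ := hle U hU
      have h3 := aux_diff P U h2
      rw [hPd, hdim U h1] at h3
      rw [Finset.bipartiteAbove, Finset.filter_filter]
      simp only [and_comm] at h3 ⊢
      rw [h3]
      norm_num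
    · intro z hz
      rw [Finset.card_le_one]
      intro U hU W hW
      rw [Finset.mem_bipartiteBelow] at hU hW
      by_contra hne
      obtain ⟨u1, u2⟩ := hle U hU.1
      obtain ⟨w1, w2⟩ := hle W hW.1
      have hz' : z ∉ P := (Finset.mem_filter.1 hz).2
      have hlt : P < U ⊓ W := lt_of_le_of_ne (le_inf u2 w2) (by
        intro h
        exact hz' (h ▸ ⟨hU.2, hW.2⟩))
      have := Submodule.finrank_lt_finrank_of_lt hlt
      have := hdist U u1 W w1 hne
      rw [hdim U u1, hdim W w1] at this
      omega
end

section
/- For all natural numbers r ≥ 4 and j ≤ 2r, there is no projective 2^r-divisible binary linear code of effective length 3 + j·2^r (of any dimension k ≥ 1). -/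
/-- Hamming weight of a binary vector. -/
def hwt {n : ℕ} (c : Fin n → ZMod 2) : ℕ :=
  (Finset.univ.filter fun i => c i ≠ 0).card

namespace PD

open Finset

def sgn (a : ZMod 2) : ℤ := if a = 0 then 1 else -1
def ind (a : ZMod 2) : ℤ := if a = 0 then 0 else 1

lemma sgn_add (a b : ZMod 2) : sgn (a + b) = sgn a * sgn b := by
  revert a b; decide
lemma two_ind (a : ZMod 2) : 2 * ind a = 1 - sgn a := by
  revert a; decide
lemma ind_nonneg (a : ZMod 2) : 0 ≤ ind a := by
  revert a; decide
lemma ind_le (a : ZMod 2) : ind a ≤ 1 := by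
  revert a; decide
lemma ind_add (a b : ZMod 2) : ind (a + b) ≤ ind a + ind b := by
  revert a b; decide
lemma ind_res (a b : ZMod 2) :
    (if b = 0 then 2 * ind a else 0) = ind a + ind (a + b) - ind b := by
  revert a b; decide

variable {V : Type} [AddCommGroup V] [Module (ZMod 2) V] [Fintype V]

abbrev Du (V : Type) [AddCommGroup V] [Module (ZMod 2) V] := Module.Dual (ZMod 2) V

def W (K : Finset (Du V)) (v : V) : ℤ := ∑ f ∈ K, ind (f v)
def T (K : Finset (Du V)) (v : V) : ℤ := ∑ f ∈ K, sgn (f v)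
def R (K : Finset (Du V)) (c : V) : Finset (Du V) := K.filter (fun f => f c = 0)

def D (r : ℕ) (K : Finset (Du V)) : Prop := (0 : Du V) ∉ K ∧ ∀ v, (2 ^ r : ℤ) ∣ W K v

omit [Fintype V] in
lemma W_T (K : Finset (Du V)) (v : V) : 2 * W K v = K.card - T K v := by
  simp only [W, T, mul_sum, two_ind, sum_sub_distrib]
  simp

omit [Fintype V] in
lemma W_nonneg (K : Finset (Du V)) (v : V) : 0 ≤ W K v :=
  sum_nonneg fun _ _ => ind_nonneg _

omit [Fintype V] in
lemma W_le (K : Finset (Du V)) (v : V) : W K v ≤ K.card := by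
  calc W K v ≤ ∑ f ∈ K, (1:ℤ) := sum_le_sum fun _ _ => ind_le _
    _ = _ := by simp

omit [Fintype V] in
lemma W_zero (K : Finset (Du V)) : W K 0 = 0 := by
  simp [W, ind]

omit [Fintype V] in
lemma W_add (K : Finset (Du V)) (u v : V) : W K (u + v) ≤ W K u + W K v := by
  simp only [W, ← sum_add_distrib]
  exact sum_le_sum fun f _ => by rw [map_add]; exact ind_add _ _

omit [Fintype V] in
lemma W_R (K : Finset (Du V)) (c v : V) :
    2 * W (R K c) v = W K v + W K (v + c) - W K c := by
  simp only [W, R, sum_filter, mul_sum, ← sum_add_distrib, ← sum_sub_distrib]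
  refine sum_congr rfl fun f _ => ?_
  rw [map_add, ← ind_res]
  split_ifs <;> simp

omit [Fintype V] in
lemma card_R (K : Finset (Du V)) (c : V) : ((R K c).card : ℤ) = K.card - W K c := by
  have h : (K.card : ℤ) = ∑ f ∈ K, (1:ℤ) := by simp
  rw [h, R, card_filter, W, ← sum_sub_distrib]
  push_cast
  refine sum_congr rfl fun f _ => ?_
  unfold ind
  split_ifs <;> simp

omit [Fintype V] in
lemma D_R {r : ℕ} {K : Finset (Du V)} (h : D (r + 1) K) (c : V) : D r (R K c) := by
  refine ⟨fun h0 => h.1 (mem_of_mem_filter _ h0), fun v => ?_⟩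
  have h1 : (2 ^ (r+1) : ℤ) ∣ 2 * W (R K c) v := by
    rw [W_R]
    exact dvd_sub (dvd_add (h.2 _) (h.2 _)) (h.2 _)
  rw [pow_succ, mul_comm] at h1
  exact (mul_dvd_mul_iff_left (by norm_num)).1 h1

omit [Fintype V] in
lemma D_mono {r : ℕ} {K : Finset (Du V)} (h : D (r + 1) K) : D r K :=
  ⟨h.1, fun v => (pow_dvd_pow _ (Nat.le_succ r)).trans (h.2 v)⟩

lemma sum_sgn {f : Du V} (hf : f ≠ 0) : ∑ v, sgn (f v) = 0 := by
  obtain ⟨u, hu⟩ : ∃ u, f u ≠ 0 := by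
    by_contra! h
    exact hf (LinearMap.ext h)
  have h1 : ∑ v, sgn (f (v + u)) = ∑ v, sgn (f v) :=
    Equiv.sum_comp (Equiv.addRight u) (fun v => sgn (f v))
  have h2 : ∑ v, sgn (f (v + u)) = - ∑ v, sgn (f v) := by
    rw [← sum_neg_distrib]
    refine sum_congr rfl fun v _ => ?_
    rw [map_add, sgn_add]
    simp [sgn, hu]
  linarith

lemma sum_sgn_zero : ∑ v : V, sgn ((0 : Du V) v) = Fintype.card V := by
  simp [sgn]

lemma sum_sgn_nonneg (f : Du V) : 0 ≤ ∑ v, sgn (f v) := by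
  by_cases hf : f = 0
  · subst hf; rw [sum_sgn_zero]; positivity
  · rw [sum_sgn hf]

omit [Fintype V] in
lemma du_add_eq_zero {f g : Du V} : f + g = 0 ↔ f = g := by
  constructor
  · intro h
    have h2 : g + g = 0 := by
      ext v
      simp only [LinearMap.add_apply, LinearMap.zero_apply]
      generalize g v = a
      revert a; decide
    exact add_right_cancel (h.trans h2.symm)
  · rintro rfl
    ext v
    simp only [LinearMap.add_apply, LinearMap.zero_apply]
    generalize f v = a
    revert a; decide

lemma sum_chi_T {K : Finset (Du V)} {p : Du V} (hp : p ∈ K) :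
    ∑ v, sgn (p v) * T K v = Fintype.card V := by
  classical
  simp only [T, mul_sum, ← sgn_add]
  rw [sum_comm, sum_eq_single p]
  · rw [← sum_sgn_zero]
    refine sum_congr rfl fun v _ => ?_
    congr 1
    rw [← LinearMap.add_apply, du_add_eq_zero.2 rfl]
  · intro f _ hfp
    exact sum_sgn (f := p + f) (fun h => hfp (du_add_eq_zero.1 h).symm)
  · exact fun h => absurd hp h

lemma T1 {K : Finset (Du V)} (h0 : (0 : Du V) ∉ K) : ∑ v, T K v = 0 := by
  simp only [T]
  rw [sum_comm]
  exact sum_eq_zero fun f hf => sum_sgn (fun h => h0 (h ▸ hf))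

lemma T2 (K : Finset (Du V)) : ∑ v, T K v ^ 2 = K.card * Fintype.card V := by
  have h : ∀ v, T K v ^ 2 = ∑ f ∈ K, sgn (f v) * T K v := fun v => by
    rw [← sum_mul, sq]; rfl
  simp only [h]
  rw [sum_comm, sum_congr rfl fun f hf => sum_chi_T hf]
  simp

lemma T3 (K : Finset (Du V)) : 0 ≤ ∑ v, T K v ^ 3 := by
  have h : ∀ v, T K v ^ 3 = ∑ f ∈ K, ∑ g ∈ K, ∑ h ∈ K, sgn ((f + g + h) v) := fun v => by
    simp only [LinearMap.add_apply, sgn_add, ← mul_sum, ← sum_mul]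
    rw [pow_succ, sq]; rfl
  simp only [h]
  rw [sum_comm]
  refine sum_nonneg fun f _ => ?_
  rw [sum_comm]
  refine sum_nonneg fun g _ => ?_
  rw [sum_comm]
  exact sum_nonneg fun k _ => sum_sgn_nonneg _

lemma M0 (a : ℤ) : ∑ _v : V, a = a * Fintype.card V := by
  simp [mul_comm]

lemma M1 {K : Finset (Du V)} (h0 : (0 : Du V) ∉ K) :
    2 * ∑ v, W K v = K.card * Fintype.card V := by
  rw [mul_sum]
  simp only [W_T, sum_sub_distrib, T1 h0, M0]
  ring

lemma M2 {K : Finset (Du V)} (h0 : (0 : Du V) ∉ K) :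
    4 * ∑ v, W K v ^ 2 = K.card * (K.card + 1) * Fintype.card V := by
  have h : ∀ v, 4 * W K v ^ 2 = (K.card:ℤ) ^ 2 - 2 * K.card * T K v + T K v ^ 2 := fun v => by
    have := W_T K v
    calc 4 * W K v ^ 2 = (2 * W K v) ^ 2 := by ring
      _ = _ := by rw [this]; ring
  rw [mul_sum]
  simp only [h, sum_add_distrib, sum_sub_distrib, ← mul_sum, T1 h0, T2, M0]
  ring

lemma M3 {K : Finset (Du V)} (h0 : (0 : Du V) ∉ K) :
    8 * ∑ v, W K v ^ 3 ≤ K.card ^ 2 * (K.card + 3) * Fintype.card V := by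
  have h : ∀ v, 8 * W K v ^ 3 = (K.card:ℤ) ^ 3 - 3 * K.card ^ 2 * T K v
      + 3 * K.card * T K v ^ 2 - T K v ^ 3 := fun v => by
    have := W_T K v
    calc 8 * W K v ^ 3 = (2 * W K v) ^ 3 := by ring
      _ = _ := by rw [this]; ring
  rw [mul_sum]
  simp only [h, sum_add_distrib, sum_sub_distrib, ← mul_sum, T1 h0, T2, M0]
  linarith [T3 K]

lemma Npos : (0:ℤ) < Fintype.card V := by
  exact_mod_cast Fintype.card_pos

/-- quadratic moment: `4 Σ (w-a)(w-b)`. -/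
lemma MQ {K : Finset (Du V)} (h0 : (0 : Du V) ∉ K) (a b : ℤ) :
    4 * ∑ v, (W K v - a) * (W K v - b) =
      (K.card * (K.card + 1) - 2 * (a + b) * K.card + 4 * a * b) * Fintype.card V := by
  have h : ∀ v, (W K v - a) * (W K v - b) = W K v ^ 2 - (a + b) * W K v + a * b := fun v => by
    ring
  simp only [h, sum_add_distrib, sum_sub_distrib, ← mul_sum, M0]
  linear_combination M2 h0 - 2 * (a + b) * M1 h0

lemma exists_big {K : Finset (Du V)} (h0 : (0 : Du V) ∉ K) :
    ∃ v, (K.card : ℤ) ≤ 2 * W K v := by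
  by_contra! h
  have h1 : ∑ v, 2 * W K v < ∑ _v : V, (K.card : ℤ) :=
    sum_lt_sum_of_nonempty ⟨0, mem_univ _⟩ fun v _ => h v
  rw [← mul_sum, M1 h0, M0] at h1
  exact lt_irrefl _ h1

lemma no3 {r : ℕ} {K : Finset (Du V)} (h : D (r + 2) K) (hn : K.card = 3) : False := by
  obtain ⟨v, hv⟩ := exists_big h.1
  have h1 := W_le K v
  obtain ⟨m, hm⟩ := (pow_dvd_pow (2:ℤ) (show 2 ≤ r + 2 by omega)).trans (h.2 v)
  rw [hn] at h1 hv
  push_cast at h1 hv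
  omega

lemma no11 {K : Finset (Du V)} (h : D 2 K) (hn : K.card = 11) : False := by
  have h1 := MQ h.1 4 8
  rw [hn] at h1
  have h2 : 0 ≤ ∑ v, (W K v - 4) * (W K v - 8) := sum_nonneg fun v _ => by
    obtain ⟨m, hm⟩ := h.2 v
    rw [hm]
    rcases le_or_gt m 1 with h | h
    · nlinarith
    · nlinarith
  have := Npos (V := V)
  norm_num at h1
  linarith

lemma no19 {K : Finset (Du V)} (h : D 3 K) (hn : K.card = 19) : False := by
  obtain ⟨v, hv⟩ := exists_big h.1
  have h1 := W_le K v
  obtain ⟨m, hm⟩ := h.2 v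
  have h3 := card_R K v
  have hR := D_R h v
  have n3 : (R K v).card ≠ 3 := @no3 V _ _ _ 0 _ hR
  rw [hn] at h1 hv h3
  push_cast at h1 hv h3
  omega

lemma no35 {K : Finset (Du V)} (h : D 3 K) (hn : K.card = 35) : False := by
  obtain ⟨v, hv⟩ := exists_big h.1
  have h1 := W_le K v
  obtain ⟨m, hm⟩ := h.2 v
  have h3 := card_R K v
  have hR := D_R h v
  have n3 : (R K v).card ≠ 3 := @no3 V _ _ _ 0 _ hR
  have n11 : (R K v).card ≠ 11 := no11 hR
  rw [hn] at h1 hv h3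
  push_cast at h1 hv h3
  omega

def e (K : Finset (Du V)) (a : ℤ) (v : V) : ℤ := if W K v = a then 1 else 0
def A (K : Finset (Du V)) (a : ℤ) : ℤ := ∑ v, e K a v

lemma A_card (K : Finset (Du V)) (a : ℤ) : A K a = (univ.filter fun v => W K v = a).card := by
  simp only [A, e, card_filter]
  push_cast
  rfl

lemma A_nonneg (K : Finset (Du V)) (a : ℤ) : 0 ≤ A K a := by
  rw [A_card]; positivity

omit [Fintype V] in
lemma W_eq_zero {K : Finset (Du V)} {v : V} : W K v = 0 ↔ ∀ f ∈ K, f v = 0 := by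
  rw [W, sum_eq_zero_iff_of_nonneg fun _ _ => ind_nonneg _]
  simp [ind]

omit [Fintype V] in
lemma W_add_ker {K : Finset (Du V)} {u v : V} (hu : W K u = 0) : W K (v + u) = W K v := by
  rw [W_eq_zero] at hu
  refine sum_congr rfl fun f hf => ?_
  rw [map_add, hu f hf, add_zero]

lemma A0_pow (K : Finset (Du V)) : ∃ b : ℕ, A K 0 = 2 ^ b := by
  classical
  let S : Submodule (ZMod 2) V :=
    { carrier := {v | W K v = 0}
      add_mem' := fun {a b} ha hb => by
        simp only [Set.mem_ofPred_eq] at *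
        rw [W_add_ker hb, ha]
      zero_mem' := W_zero K
      smul_mem' := fun c x hx => by
        simp only [Set.mem_ofPred_eq, W_eq_zero] at *
        intro f hf
        rw [map_smul, hx f hf, smul_zero] }
  refine ⟨Module.finrank (ZMod 2) S, ?_⟩
  have h1 := Module.card_eq_pow_finrank (K := ZMod 2) (V := S)
  rw [ZMod.card] at h1
  rw [A_card]
  have h2 : Fintype.card S = (univ.filter fun v => W K v = 0).card := by
    rw [Fintype.card_subtype]
    congr 1
    ext v
    simp only [mem_filter, mem_univ, true_and]
    exact Iff.rfl
  rw [← h2, h1]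
  push_cast
  rfl

lemma N_pow : ∃ a : ℕ, (Fintype.card V : ℤ) = 2 ^ a := by
  refine ⟨Module.finrank (ZMod 2) V, ?_⟩
  have h1 := Module.card_eq_pow_finrank (K := ZMod 2) (V := V)
  rw [ZMod.card] at h1
  rw [h1]; push_cast; rfl

lemma coset_le (K : Finset (Du V)) (u : V) : A K 0 ≤ A K (W K u) := by
  classical
  rw [A_card, A_card]
  norm_cast
  refine card_le_card_of_injOn (fun v => u + v) ?_ ?_
  · intro v hv
    simp only [coe_filter, mem_univ, true_and, Set.mem_ofPred_eq] at *
    exact W_add_ker hv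
  · exact fun a _ b _ h => add_left_cancel h

omit [Fintype V] in
lemma add_self' (v : V) : v + v = 0 := by
  have : (2 : ZMod 2) • v = 0 := by
    rw [show (2 : ZMod 2) = 0 from rfl, zero_smul]
  rwa [two_smul] at this

lemma w51 {K : Finset (Du V)} (h : D 3 K) (hn : K.card = 51) (v : V) :
    W K v = 0 ∨ W K v = 8 ∨ W K v = 16 ∨ W K v = 24 ∨ W K v = 32 := by
  have h0 := W_nonneg K v
  have h1 := W_le K v
  obtain ⟨m, hm⟩ := h.2 v
  have h3 := card_R K v
  have hR := D_R h v
  have n3 : (R K v).card ≠ 3 := @no3 V _ _ _ 0 _ hR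
  have n11 : (R K v).card ≠ 11 := no11 hR
  rw [hn] at h1 h3
  push_cast at h1 h3
  omega

lemma l51 {K : Finset (Du V)} (h : D 3 K) (hn : K.card = 51) (v : V) :
    W K v = 0 ∨ W K v = 24 ∨ W K v = 32 := by
  classical
  have hw := w51 h hn
  obtain ⟨N, hN⟩ : ∃ N : ℤ, N = Fintype.card V := ⟨_, rfl⟩
  have hNp : 0 < N := hN ▸ Npos
  have e2 : 128 * A K 16 + 384 * A K 8 + 768 * A K 0 = 3 * N := by
    have h1 := MQ h.1 24 32
    rw [hn] at h1
    have h2 : ∑ v, (W K v - 24) * (W K v - 32)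
        = 128 * A K 16 + 384 * A K 8 + 768 * A K 0 := by
      simp only [A, mul_sum, ← sum_add_distrib]
      refine sum_congr rfl fun v _ => ?_
      rcases hw v with h | h | h | h | h <;> simp [e, h]
    rw [h2, ← hN] at h1
    norm_num at h1
    linarith
  have e3 : 4 * (2048 * A K 16 + 3072 * A K 8) ≤ 51 * N := by
    have h1 := M3 h.1
    have h1' := M2 h.1
    have h1'' := M1 h.1
    rw [hn, ← hN] at h1 h1' h1''
    have h2 : ∑ v, (W K v ^ 3 - 56 * W K v ^ 2 + 768 * W K v)
        = 2048 * A K 16 + 3072 * A K 8 := by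
      simp only [A, mul_sum, ← sum_add_distrib]
      refine sum_congr rfl fun v _ => ?_
      rcases hw v with h | h | h | h | h <;> simp [e, h]
    rw [← h2]
    simp only [sum_add_distrib, sum_sub_distrib, ← mul_sum]
    norm_num at h1 h1' h1''
    linarith
  have p8 := A_nonneg K 8
  have p16 := A_nonneg K 16
  obtain ⟨b, hb⟩ := A0_pow K
  obtain ⟨a, ha⟩ := N_pow (V := V)
  have hZ : 0 < A K 0 := by rw [hb]; positivity
  have l1 : 256 * A K 0 ≤ N := by linarith
  have l2 : N < 1024 * A K 0 := by linarith
  have hab : N = 256 * A K 0 ∨ N = 512 * A K 0 := by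
    have q1 : (2:ℤ) ^ (b + 8) ≤ 2 ^ a := by
      rw [← ha, ← hN, pow_add, ← hb]; linarith
    have q2 : (2:ℤ) ^ a < 2 ^ (b + 10) := by
      rw [← ha, ← hN, pow_add, ← hb]; linarith
    have q1' := (pow_le_pow_iff_right₀ (by norm_num : (1:ℤ) < 2)).1 q1
    have q2' := (pow_lt_pow_iff_right₀ (by norm_num : (1:ℤ) < 2)).1 q2
    have : a = b + 8 ∨ a = b + 9 := by omega
    rcases this with rfl | rfl
    · left; rw [hN, ha, hb, pow_add]; ring
    · right; rw [hN, ha, hb, pow_add]; ring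
  have key : A K 8 = 0 ∧ A K 16 = 0 := by
    rcases hab with hab | hab
    · constructor <;> linarith
    · exfalso
      have b8 : A K 0 < A K 8 := by linarith
      have b8' : A K 8 ≤ 2 * A K 0 := by linarith
      have b16 : A K 16 < A K 0 := by linarith
      obtain ⟨u, hu⟩ : ∃ u, W K u = 8 := by
        by_contra! hc
        have : A K 8 = 0 := by simp [A, e, hc]
        linarith
      obtain ⟨u', hu', hne⟩ : ∃ u', W K u' = 8 ∧ W K (u + u') ≠ 0 := by
        by_contra! hc
        have : A K 8 ≤ A K 0 := by
          rw [A_card, A_card]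
          norm_cast
          refine card_le_card_of_injOn (fun v => u + v) ?_ ?_
          · intro v hv
            simp only [coe_filter, mem_univ, true_and, Set.mem_ofPred_eq] at *
            exact hc v hv
          · exact fun a _ b _ h => add_left_cancel h
        linarith
      have hle := W_add K u u'
      have h816 : W K (u + u') = 8 ∨ W K (u + u') = 16 := by
        rcases hw (u + u') with h | h | h | h | h <;> omega
      rcases h816 with h8 | h16
      · have : 3 * A K 0 ≤ A K 8 := by
          have hd : ∀ v, e K 0 (u + v) + e K 0 (u' + v) + e K 0 (u + u' + v) ≤ e K 8 v := by
            intro v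
            have k1 : W K (u + v) = 0 → W K v = 8 := fun hk => by
              have := W_add_ker (v := u) hk
              rw [← add_assoc, add_self', zero_add] at this
              rw [this, hu]
            have k2 : W K (u' + v) = 0 → W K v = 8 := fun hk => by
              have := W_add_ker (v := u') hk
              rw [← add_assoc, add_self', zero_add] at this
              rw [this, hu']
            have k3 : W K (u + u' + v) = 0 → W K v = 8 := fun hk => by
              have := W_add_ker (v := u + u') hk
              rw [← add_assoc, add_self', zero_add] at this
              rw [this, h8]
            have k12 : W K (u + v) = 0 → W K (u' + v) = 0 → False := fun h1 h2 => by
              have := W_add_ker (v := u + v) h2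
              rw [show u + v + (u' + v) = u + u' + (v + v) by abel, add_self', add_zero] at this
              omega
            have k13 : W K (u + v) = 0 → W K (u + u' + v) = 0 → False := fun h1 h2 => by
              have := W_add_ker (v := u + v) h2
              rw [show u + v + (u + u' + v) = (u + u) + u' + (v + v) by abel, add_self',
                add_self', add_zero, zero_add] at this
              omega
            have k23 : W K (u' + v) = 0 → W K (u + u' + v) = 0 → False := fun h1 h2 => by
              have := W_add_ker (v := u' + v) h2
              rw [show u' + v + (u + u' + v) = (u' + u') + u + (v + v) by abel, add_self',
                add_self', add_zero, zero_add] at this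
              omega
            unfold e
            split_ifs <;> simp_all
          have ht : ∀ t : V, ∑ v, e K 0 (t + v) = A K 0 := fun t =>
            Equiv.sum_comp (Equiv.addLeft t) (fun v => e K 0 v)
          have := sum_le_sum fun v (_ : v ∈ univ) => hd v
          rw [sum_add_distrib, sum_add_distrib, ht, ht, ht] at this
          change _ ≤ A K 8 at this
          linarith
        linarith
      · have := coset_le K (u + u')
        rw [h16] at this
        linarith
  have c1 := coset_le K v
  rcases hw v with h | h | h | h | h
  · exact Or.inl h
  · rw [h] at c1; linarith [key.1]
  · rw [h] at c1; linarith [key.2]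
  · exact Or.inr (Or.inl h)
  · exact Or.inr (Or.inr h)

lemma no115 {K : Finset (Du V)} (h : D 4 K) (hn : K.card = 115) : False := by
  have h1 := MQ h.1 48 64
  rw [hn] at h1
  have h2 : 0 ≤ ∑ v, (W K v - 48) * (W K v - 64) := sum_nonneg fun v _ => by
    obtain ⟨m, hm⟩ := h.2 v
    rw [hm]
    rcases le_or_gt m 3 with h | h
    · nlinarith
    · nlinarith
  have := Npos (V := V)
  norm_num at h1
  linarith

lemma no131 {K : Finset (Du V)} (h : D 4 K) (hn : K.card = 131) : False := by
  have hNp := Npos (V := V)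
  have hw : ∀ v, W K v = 0 ∨ W K v = 16 ∨ W K v = 32 ∨ W K v = 48 ∨ W K v = 64 ∨ W K v = 80 := by
    intro v
    have h0 := W_nonneg K v
    have h1 := W_le K v
    obtain ⟨m, hm⟩ := h.2 v
    have h3 := card_R K v
    have hR := D_R h v
    have n3 : (R K v).card ≠ 3 := @no3 V _ _ _ 1 _ hR
    have n19 : (R K v).card ≠ 19 := no19 hR
    have n35 : (R K v).card ≠ 35 := no35 hR
    rw [hn] at h1 h3
    push_cast at h1 h3
    omega
  have h80 : ∀ c, W K c = 80 → ∀ v,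
      W (R K c) v = 0 ∨ W (R K c) v = 24 ∨ W (R K c) v = 32 := by
    intro c hc
    have h3 := card_R K c
    rw [hn, hc] at h3
    exact l51 (D_R h c) (by push_cast at h3; omega)
  -- no light words
  have light : ∀ l, W K l ≠ 16 ∧ W K l ≠ 32 := by
    intro l
    by_contra hl
    have hl' : W K l = 16 ∨ W K l = 32 := by tauto
    obtain ⟨p, hp, hpl⟩ : ∃ p ∈ K, p l ≠ 0 := by
      by_contra! hc
      have := W_eq_zero.2 hc
      omega
    have h5 : ∀ c, W K c = 80 → p c ≠ 0 := by
      intro c hc hpc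
      have h6 := W_R K c l
      have h7 : W (R K c) l = 0 := by
        have := hw (l + c)
        have := h80 c hc l
        omega
      exact hpl (W_eq_zero.1 h7 p (by simp [R, hp, hpc]))
    have h8 : ∑ v, (1 + sgn (p v)) * (W K v - 64) ≤ 0 := sum_nonpos fun v _ => by
      by_cases hc : W K v = 80
      · simp [sgn, h5 v hc]
      · have : W K v - 64 ≤ 0 := by have := hw v; omega
        have h9 : 0 ≤ 1 + sgn (p v) := by unfold sgn; split_ifs <;> norm_num
        nlinarith
    have h9 : ∀ v, 2 * ((1 + sgn (p v)) * (W K v - 64)) =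
        2 * W K v - 128 + (3 * sgn (p v) - sgn (p v) * T K v) := fun v => by
      have := W_T K v
      rw [hn] at this
      push_cast at this
      linear_combination sgn (p v) * this
    have h10 : 2 * ∑ v, (1 + sgn (p v)) * (W K v - 64) ≤ 0 := by linarith
    have hp0 : p ≠ 0 := fun h' => h.1 (h' ▸ hp)
    rw [mul_sum, sum_congr rfl fun v _ => h9 v] at h10
    simp only [sum_add_distrib, sum_sub_distrib, ← mul_sum, M0, sum_chi_T hp, sum_sgn hp0,
      M1 h.1, hn] at h10
    push_cast at h10
    linarith
  have hw' : ∀ v, W K v = 0 ∨ W K v = 48 ∨ W K v = 64 ∨ W K v = 80 := by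
    intro v
    have := hw v
    have := light v
    omega
  have q1 : 512 * A K 48 + 5120 * A K 0 = 11 * Fintype.card V := by
    have h1 := MQ h.1 64 80
    rw [hn] at h1
    have h2 : ∑ v, (W K v - 64) * (W K v - 80) = 512 * A K 48 + 5120 * A K 0 := by
      simp only [A, mul_sum, ← sum_add_distrib]
      refine sum_congr rfl fun v _ => ?_
      rcases hw' v with h | h | h | h <;> simp [e, h]
    rw [h2] at h1
    norm_num at h1
    linarith
  have q2 : 512 * A K 80 + 3072 * A K 0 = 59 * Fintype.card V := by
    have h1 := MQ h.1 48 64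
    rw [hn] at h1
    have h2 : ∑ v, (W K v - 48) * (W K v - 64) = 512 * A K 80 + 3072 * A K 0 := by
      simp only [A, mul_sum, ← sum_add_distrib]
      refine sum_congr rfl fun v _ => ?_
      rcases hw' v with h | h | h | h <;> simp [e, h]
    rw [h2] at h1
    norm_num at h1
    linarith
  obtain ⟨c0, hc0⟩ : ∃ c, W K c = 48 := by
    by_contra! hc
    have hz : A K 48 = 0 := by simp [A, e, hc]
    obtain ⟨b, hb⟩ := A0_pow K
    rw [hz, hb] at q1
    have hd : (11:ℤ) ∣ 2 ^ (b + 10) * 5 := ⟨Fintype.card V, by rw [← q1]; ring⟩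
    have p11 : Prime (11:ℤ) := by norm_num
    rcases p11.dvd_or_dvd hd with h | h
    · have := p11.dvd_of_dvd_pow h
      omega
    · omega
  have q3 : 384 * A K 80 ≤ 35 * Fintype.card V := by
    have hR := D_R h c0
    have h3 := card_R K c0
    rw [hn, hc0] at h3
    have h4 : (R K c0).card = 83 := by push_cast at h3; omega
    have h1 := MQ hR.1 40 32
    rw [h4] at h1
    have h2 : 384 * A K 80 ≤ ∑ v, (W (R K c0) v - 40) * (W (R K c0) v - 32) := by
      simp only [A, mul_sum]
      refine sum_le_sum fun v _ => ?_
      by_cases hv : W K v = 80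
      · have h5 := W_R K c0 v
        have h6 := W_R K v c0
        have h7 := h80 v hv c0
        have h8 := hw' (v + c0)
        rw [add_comm c0 v] at h6
        have h9 : W (R K c0) v = 56 := by omega
        simp [e, hv, h9]
      · obtain ⟨m, hm⟩ := hR.2 v
        simp only [e, hv, if_false, hm]
        rcases le_or_gt m 4 with h | h
        · nlinarith
        · nlinarith
    norm_num at h1
    linarith
  have := A_nonneg K 48
  linarith

lemma main (r : ℕ) : ∀ (j : ℕ) (K : Finset (Du V)), j ≤ 2 * (r + 4) → D (r + 4) K →
    K.card = 3 + j * 2 ^ (r + 4) → False := by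
  induction r with
  | zero =>
    intro j K hj h hn
    by_cases h7 : j = 7
    · subst h7; exact no115 h hn
    by_cases h8 : j = 8
    · subst h8; exact no131 h hn
    obtain ⟨v, hv⟩ := exists_big h.1
    have h1 := W_le K v
    obtain ⟨m, hm⟩ := h.2 v
    have h3 := card_R K v
    have hR := D_R h v
    have n3 : (R K v).card ≠ 3 := @no3 V _ _ _ 1 _ hR
    have n19 : (R K v).card ≠ 19 := no19 hR
    have n35 : (R K v).card ≠ 35 := no35 hR
    rw [hn] at h1 h3 hv
    push_cast at h1 h3 hv
    norm_num at h1 h3 hv hm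
    omega
  | succ r ih =>
    intro j K hj h hn
    obtain ⟨v, hv⟩ := exists_big h.1
    have h1 := W_le K v
    obtain ⟨m, hm⟩ := h.2 v
    have h3 := card_R K v
    have hR : D (r + 4) (R K v) := D_R (by rwa [show r + 4 + 1 = r + 1 + 4 by ring]) v
    rw [hn] at h1 h3 hv
    push_cast at h1 h3 hv
    have hq : (16:ℤ) ≤ 2 ^ (r + 4) := by
      rw [pow_add]; nlinarith [one_le_pow₀ (by norm_num : (1:ℤ) ≤ 2) (n := r)]
    have hq' : (2:ℤ) ^ (r + 1 + 4) = 2 * 2 ^ (r + 4) := by ring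
    rw [hm, hq'] at h1 h3 hv
    have hmj : m ≤ j := by
      by_contra! hc
      nlinarith
    have hmj2 : (j:ℤ) < 2 * m := by
      by_contra! hc
      nlinarith
    obtain ⟨d, hd⟩ : ∃ d : ℕ, (d : ℤ) = j - m := ⟨(j - m).toNat, by omega⟩
    refine ih (2 * d) (R K v) (by omega) hR ?_
    zify
    rw [h3, hd]
    ring

end PD

/-- For `r ≥ 4` and `j ≤ 2r`, no projective `2^r`-divisible binary linear code of
effective length `3 + j·2^r` (of any dimension `k ≥ 1`) exists. -/
theorem no_projective_divisible (r j : ℕ) (hr : 4 ≤ r) (hj : j ≤ 2 * r) :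
    ¬ ∃ C : Submodule (ZMod 2) (Fin (3 + j * 2 ^ r) → ZMod 2),
      1 ≤ Module.finrank (ZMod 2) C ∧
      (∀ i, ∃ c ∈ C, c i ≠ 0) ∧
      (∀ i j', i ≠ j' → ∃ c ∈ C, c i ≠ c j') ∧
      (∀ c ∈ C, 2 ^ r ∣ hwt c) := by
  classical
  rintro ⟨C, -, heff, hproj, hdiv⟩
  obtain ⟨s, rfl⟩ : ∃ s, r = s + 4 := ⟨r - 4, by omega⟩
  let φ : Fin (3 + j * 2 ^ (s + 4)) → PD.Du C := fun i =>
    (LinearMap.proj i : (Fin (3 + j * 2 ^ (s + 4)) → ZMod 2) →ₗ[ZMod 2] ZMod 2).comp C.subtype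
  have hφ : ∀ i (c : C), φ i c = c.1 i := fun i c => rfl
  have hinj : Function.Injective φ := by
    intro a b hab
    by_contra hne
    obtain ⟨c, hc, hcne⟩ := hproj a b hne
    exact hcne (LinearMap.congr_fun hab ⟨c, hc⟩)
  letI : Fintype C := Fintype.ofFinite C
  refine PD.main (V := C) s j (Finset.univ.map ⟨φ, hinj⟩) hj ⟨?_, ?_⟩ (by simp)
  · intro h0
    simp only [Finset.mem_map, Finset.mem_univ, true_and, Function.Embedding.coeFn_mk] at h0
    obtain ⟨i, hi⟩ := h0
    obtain ⟨c, hc, hcne⟩ := heff i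
    exact hcne (LinearMap.congr_fun hi ⟨c, hc⟩)
  · intro v
    have h1 : PD.W (Finset.univ.map ⟨φ, hinj⟩) v = (hwt v.1 : ℤ) := by
      simp only [PD.W, Finset.sum_map, Function.Embedding.coeFn_mk, hφ, hwt, Finset.card_filter]
      push_cast
      refine Finset.sum_congr rfl fun i _ => ?_
      unfold PD.ind
      split_ifs <;> simp_all
    rw [h1]
    exact_mod_cast hdiv v.1 v.2
end

section
/- Let C be a projective 8-divisible binary linear code of effective length 51. Then C has dimension 8, every nonzero codeword of C has Hamming weight 24 or 32, exactly 204 codewords have weight 24, and exactly 51 codewords have weight 32 (i.e., the weight enumerator is W(z) = 1 + 204·z^24 + 51·z^32). -/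
def chi2 (a : ZMod 2) : ℤ := if a = 0 then 1 else -1

def ind2 (a : ZMod 2) : ℕ := if a ≠ 0 then 1 else 0

lemma chi2_add : ∀ a b : ZMod 2, chi2 (a + b) = chi2 a * chi2 b := by decide

lemma chi2_ind : ∀ a : ZMod 2, chi2 a = 1 - 2 * (ind2 a : ℤ) := by decide

lemma ind2_add : ∀ a b : ZMod 2, ind2 (a + b) + 2 * (ind2 a * ind2 b) = ind2 a + ind2 b := by
  decide

lemma hwt_eq {n : ℕ} (c : Fin n → ZMod 2) : hwt c = ∑ i, ind2 (c i) := by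
  unfold hwt ind2
  rw [Finset.card_filter]

open Classical in
noncomputable def codeF (C : Submodule (ZMod 2) (Fin 51 → ZMod 2)) :
    Finset (Fin 51 → ZMod 2) := Finset.univ.filter (· ∈ C)

lemma mem_codeF (C : Submodule (ZMod 2) (Fin 51 → ZMod 2)) (c : Fin 51 → ZMod 2) : c ∈ codeF C ↔ c ∈ C := by
  simp [codeF]

attribute [irreducible] codeF

lemma card_codeF (C : Submodule (ZMod 2) (Fin 51 → ZMod 2)) :
    (codeF C).card = 2 ^ Module.finrank (ZMod 2) C := by
  have h := Module.natCard_eq_pow_finrank (K := ZMod 2) (V := C)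
  rw [Nat.card_zmod] at h
  rw [← h, ← Nat.card_eq_finsetCard]
  exact Nat.card_congr (Equiv.subtypeEquivRight (fun c => mem_codeF C c))

lemma sum_chi_zero (C : Submodule (ZMod 2) (Fin 51 → ZMod 2))
    (f : (Fin 51 → ZMod 2) → ZMod 2) (hf : ∀ a b, f (a + b) = f a + f b)
    (h : ∃ c ∈ C, f c ≠ 0) : ∑ c ∈ codeF C, chi2 (f c) = 0 := by
  obtain ⟨c0, hc0, h1⟩ := h
  have h2 : ∑ c ∈ codeF C, chi2 (f c) = ∑ c ∈ codeF C, chi2 (f (c + c0)) := by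
    symm
    refine Finset.sum_equiv (Equiv.addRight c0) ?_ ?_
    · intro c
      simp only [mem_codeF, Equiv.coe_addRight]
      exact (Submodule.add_mem_iff_left C hc0).symm
    · intro c _; rfl
  have h3 : chi2 (f c0) = -1 := by simp [chi2, h1]
  simp only [hf, chi2_add, h3] at h2
  rw [← Finset.sum_mul] at h2
  linarith

lemma sum_chi_nonneg (C : Submodule (ZMod 2) (Fin 51 → ZMod 2))
    (f : (Fin 51 → ZMod 2) → ZMod 2) (hf : ∀ a b, f (a + b) = f a + f b) :
    0 ≤ ∑ c ∈ codeF C, chi2 (f c) := by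
  by_cases h : ∃ c ∈ C, f c ≠ 0
  · rw [sum_chi_zero C f hf h]
  · push Not at h
    apply Finset.sum_nonneg
    intro c hc
    rw [h c ((mem_codeF C c).1 hc)]
    decide

def XS (S : Finset (Fin 51)) (c : Fin 51 → ZMod 2) : ℤ := ∑ i ∈ S, chi2 (c i)

lemma moment1 (C : Submodule (ZMod 2) (Fin 51 → ZMod 2))
    (heff : ∀ i : Fin 51, ∃ c ∈ C, c i ≠ 0) (S : Finset (Fin 51)) :
    ∑ c ∈ codeF C, XS S c = 0 := by
  unfold XS
  rw [Finset.sum_comm]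
  exact Finset.sum_eq_zero fun i _ => sum_chi_zero C (fun c => c i) (fun _ _ => rfl) (heff i)

lemma moment2 (C : Submodule (ZMod 2) (Fin 51 → ZMod 2))
    (hproj : ∀ i j : Fin 51, i ≠ j → ∃ c ∈ C, c i ≠ c j) (S : Finset (Fin 51)) :
    ∑ c ∈ codeF C, XS S c ^ 2 = S.card * (codeF C).card := by
  have h : ∀ c, XS S c ^ 2 = ∑ i ∈ S, ∑ j ∈ S, chi2 (c i + c j) := by
    intro c
    simp only [XS, sq, Finset.sum_mul_sum, chi2_add]
  simp only [h]
  rw [Finset.sum_comm]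
  have h2 : ∀ i ∈ S, ∑ c ∈ codeF C, ∑ j ∈ S, chi2 (c i + c j) = (codeF C).card := by
    intro i hi
    rw [Finset.sum_comm, Finset.sum_eq_single i]
    · simp [CharTwo.add_self_eq_zero, chi2]
    · intro j _ hj
      apply sum_chi_zero C (fun c => c i + c j)
      · intro a b; simp only [Pi.add_apply]; ring
      · obtain ⟨c, hc, h⟩ := hproj i j hj.symm
        refine ⟨c, hc, ?_⟩
        rwa [Ne, CharTwo.add_eq_zero]
    · intro h; exact absurd hi h
  rw [Finset.sum_congr rfl h2]
  simp

lemma moment3 (C : Submodule (ZMod 2) (Fin 51 → ZMod 2)) (S : Finset (Fin 51)) :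
    0 ≤ ∑ c ∈ codeF C, XS S c ^ 3 := by
  have h : ∀ c, XS S c ^ 3 = ∑ i ∈ S, ∑ j ∈ S, ∑ k ∈ S, chi2 (c i + c j + c k) := by
    intro c
    have e : XS S c ^ 3 = XS S c * (XS S c * XS S c) := by ring
    rw [e]
    simp only [XS, Finset.sum_mul_sum, chi2_add]
    refine Finset.sum_congr rfl fun i _ => ?_
    refine Finset.sum_congr rfl fun j _ => ?_
    rw [Finset.mul_sum]
    refine Finset.sum_congr rfl fun k _ => ?_
    ring
  simp only [h]
  rw [Finset.sum_comm]
  refine Finset.sum_nonneg fun i _ => ?_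
  rw [Finset.sum_comm]
  refine Finset.sum_nonneg fun j _ => ?_
  rw [Finset.sum_comm]
  refine Finset.sum_nonneg fun k _ => ?_
  apply sum_chi_nonneg C (fun c => c i + c j + c k)
  intro a b; simp only [Pi.add_apply]; ring

lemma XS_eq (S : Finset (Fin 51)) (c : Fin 51 → ZMod 2) :
    XS S c = S.card - 2 * ((∑ i ∈ S, ind2 (c i) : ℕ) : ℤ) := by
  simp [XS, chi2_ind, Finset.sum_sub_distrib, Finset.mul_sum]

lemma XS_univ (c : Fin 51 → ZMod 2) : XS Finset.univ c = 51 - 2 * (hwt c : ℤ) := by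
  rw [XS_eq, hwt_eq, Finset.card_univ, Fintype.card_fin, Nat.cast_ofNat]

lemma hwt_add (c d : Fin 51 → ZMod 2) :
    hwt (c + d) + 2 * ∑ i, ind2 (c i) * ind2 (d i) = hwt c + hwt d := by
  simp only [hwt_eq, Finset.mul_sum, ← Finset.sum_add_distrib, Pi.add_apply, ind2_add]

lemma hwt_split (c d : Fin 51 → ZMod 2) :
    hwt d = ∑ i, ind2 (c i) * ind2 (d i) +
      ∑ i ∈ Finset.univ.filter (fun i => c i = 0), ind2 (d i) := by
  rw [hwt_eq, Finset.sum_filter, ← Finset.sum_add_distrib]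
  refine Finset.sum_congr rfl fun i _ => ?_
  by_cases h : c i = 0 <;> simp [h, ind2]

lemma card_compl_supp (c : Fin 51 → ZMod 2) :
    (Finset.univ.filter (fun i => c i = 0)).card + hwt c = 51 := by
  unfold hwt
  have := Finset.card_filter_add_card_filter_not (s := (Finset.univ : Finset (Fin 51)))
    (fun i => c i = 0)
  simpa using this

lemma hwt_le (C : Submodule (ZMod 2) (Fin 51 → ZMod 2))
    (heff : ∀ i : Fin 51, ∃ c ∈ C, c i ≠ 0)
    (hproj : ∀ i j : Fin 51, i ≠ j → ∃ c ∈ C, c i ≠ c j)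
    (hdiv : ∀ c ∈ C, 8 ∣ hwt c) (c : Fin 51 → ZMod 2) (hc : c ∈ C) : hwt c ≤ 32 := by
  by_contra hlt
  have h8 := hdiv c hc
  have hcard := card_compl_supp c
  set S := Finset.univ.filter (fun i => c i = 0) with hS
  have m1 := moment1 C heff S
  have m2 := moment2 C hproj S
  have hpos : 0 < (codeF C).card := by rw [card_codeF]; positivity
  have hr : ∀ d ∈ codeF C, ∃ r : ℕ, XS S d = S.card - 8 * (r : ℤ) ∧ 4 * r ≤ S.card := by
    intro d hd
    have hd' := (mem_codeF C d).1 hd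
    have e1 := hwt_add c d
    have e2 := hwt_split c d
    have e3 := XS_eq S d
    have d1 := hdiv d hd'
    have d2 := hdiv _ (C.add_mem hc hd')
    rw [← hS] at e2
    have e4 : ∑ i ∈ S, ind2 (d i) ≤ S.card := by
      have := Finset.sum_le_card_nsmul S (fun i => ind2 (d i)) 1
        (fun i _ => by unfold ind2; split_ifs <;> simp)
      simpa using this
    refine ⟨(∑ i ∈ S, ind2 (d i)) / 4, ?_, ?_⟩ <;> omega
  have hcase : S.card = 3 ∨ S.card = 11 := by omega
  rcases hcase with h | h
  · have : ∑ d ∈ codeF C, XS S d = ∑ d ∈ codeF C, 3 := by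
      refine Finset.sum_congr rfl fun d hd => ?_
      obtain ⟨r, h1, h2⟩ := hr d hd
      omega
    rw [m1] at this
    simp at this
    simp [this] at hpos
  · have : 0 ≤ ∑ d ∈ codeF C, (XS S d ^ 2 + 2 * XS S d - 15) := by
      refine Finset.sum_nonneg fun d hd => ?_
      obtain ⟨r, h1, h2⟩ := hr d hd
      have : r = 0 ∨ r = 1 ∨ r = 2 := by omega
      rw [h1, h]
      rcases this with rfl | rfl | rfl <;> norm_num
    rw [Finset.sum_sub_distrib, Finset.sum_add_distrib, ← Finset.mul_sum, m1, m2, h] at this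
    simp at this
    omega

noncomputable def Aw (C : Submodule (ZMod 2) (Fin 51 → ZMod 2)) (w : ℕ) : ℕ :=
  ((codeF C).filter (fun c => hwt c = w)).card

lemma hwt_zero_iff (c : Fin 51 → ZMod 2) : hwt c = 0 ↔ c = 0 := by
  simp [hwt, Finset.filter_eq_empty_iff, funext_iff]

lemma Aw_zero (C : Submodule (ZMod 2) (Fin 51 → ZMod 2)) : Aw C 0 = 1 := by
  unfold Aw
  rw [Finset.card_eq_one]
  refine ⟨0, ?_⟩
  ext c
  simp only [Finset.mem_filter, mem_codeF, hwt_zero_iff, Finset.mem_singleton]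
  constructor
  · exact fun h => h.2
  · rintro rfl; exact ⟨C.zero_mem, rfl⟩

lemma sum_by_weight (C : Submodule (ZMod 2) (Fin 51 → ZMod 2))
    (hw : ∀ c ∈ C, hwt c = 0 ∨ hwt c = 8 ∨ hwt c = 16 ∨ hwt c = 24 ∨ hwt c = 32) (g : ℤ → ℤ) :
    ∑ c ∈ codeF C, g (XS Finset.univ c) =
      g 51 + g 35 * Aw C 8 + g 19 * Aw C 16 + g 3 * Aw C 24 + g (-13) * Aw C 32 := by
  have h0 : g 51 = g 51 * Aw C 0 := by simp [Aw_zero]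
  rw [h0]
  simp only [Aw, Finset.card_filter, Nat.cast_sum, Finset.mul_sum, ← Finset.sum_add_distrib]
  refine Finset.sum_congr rfl fun c hc => ?_
  rw [XS_univ]
  rcases hw c ((mem_codeF C c).1 hc) with h | h | h | h | h <;> simp [h]

lemma ncard_Aw (C : Submodule (ZMod 2) (Fin 51 → ZMod 2)) (w : ℕ) :
    Set.ncard {c : Fin 51 → ZMod 2 | c ∈ C ∧ hwt c = w} = Aw C w := by
  unfold Aw
  rw [← Set.ncard_coe_finset]
  congr 1
  ext c
  simp [mem_codeF]

lemma Aw_pos (C : Submodule (ZMod 2) (Fin 51 → ZMod 2)) (c : Fin 51 → ZMod 2) (hc : c ∈ C) : Aw C (hwt c) ≠ 0 := by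
  unfold Aw
  rw [Finset.card_ne_zero]
  exact ⟨c, by simp [mem_codeF, hc]⟩

lemma arith8 (N a b c d : ℕ) (hN : N = 256)
    (e0 : (N : ℤ) = 1 + a + b + c + d)
    (e1 : (0 : ℤ) = 51 + 35 * a + 19 * b + 3 * c + -13 * d)
    (e2 : (51 : ℤ) * N = 51 ^ 2 + 35 ^ 2 * a + 19 ^ 2 * b + 3 ^ 2 * c + (-13) ^ 2 * d) :
    a = 0 ∧ b = 0 ∧ c = 204 ∧ d = 51 := by
  subst hN
  have h : (6 : ℤ) * a + 2 * b = 0 := by push_cast at *; linarith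
  have ha : a = 0 := by omega
  have hb : b = 0 := by omega
  subst ha hb
  refine ⟨rfl, rfl, ?_, ?_⟩ <;> push_cast at * <;> linarith

lemma arithN (N a b c d : ℕ)
    (e0 : (N : ℤ) = 1 + a + b + c + d)
    (e1 : (0 : ℤ) = 51 + 35 * a + 19 * b + 3 * c + -13 * d)
    (e2 : (51 : ℤ) * N = 51 ^ 2 + 35 ^ 2 * a + 19 ^ 2 * b + 3 ^ 2 * c + (-13) ^ 2 * d)
    (p3 : (0 : ℤ) ≤ 51 ^ 3 + 35 ^ 3 * a + 19 ^ 3 * b + 3 ^ 3 * c + (-13) ^ 3 * d) :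
    2 ^ 7 < N ∧ N < 2 ^ 10 ∧ (N = 512 → a = 2 ∧ b = 0) := by
  have h : 64 * (6 * (a : ℤ) + 2 * b) = 3 * N - 768 := by linarith
  have h3 : 4096 * (6 * (a : ℤ) + 4 * b) ≤ 102 * N := by linarith
  refine ⟨by omega, by omega, fun hN => ?_⟩
  subst hN
  omega

/-- A projective 8-divisible binary linear code of effective length 51 has dimension 8
and weight enumerator `1 + 204·z^24 + 51·z^32`. -/
theorem weight_enumerator_8_div_51 (C : Submodule (ZMod 2) (Fin 51 → ZMod 2))
    (heff : ∀ i : Fin 51, ∃ c ∈ C, c i ≠ 0)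
    (hproj : ∀ i j : Fin 51, i ≠ j → ∃ c ∈ C, c i ≠ c j)
    (hdiv : ∀ c ∈ C, 8 ∣ hwt c) :
    Module.finrank (ZMod 2) C = 8 ∧
    (∀ c ∈ C, c ≠ 0 → hwt c = 24 ∨ hwt c = 32) ∧
    Set.ncard {c : Fin 51 → ZMod 2 | c ∈ C ∧ hwt c = 24} = 204 ∧
    Set.ncard {c : Fin 51 → ZMod 2 | c ∈ C ∧ hwt c = 32} = 51 := by
  have hw : ∀ c ∈ C, hwt c = 0 ∨ hwt c = 8 ∨ hwt c = 16 ∨ hwt c = 24 ∨ hwt c = 32 := by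
    intro c hc
    have h1 := hwt_le C heff hproj hdiv c hc
    have h2 := hdiv c hc
    omega
  have e0 := sum_by_weight C hw (fun _ => 1)
  have e1 := sum_by_weight C hw (fun x => x)
  have e2 := sum_by_weight C hw (fun x => x ^ 2)
  have e3 := sum_by_weight C hw (fun x => x ^ 3)
  have p3 := moment3 C Finset.univ
  rw [moment1 C heff] at e1
  rw [moment2 C hproj] at e2
  rw [e3] at p3
  have hk := card_codeF C
  simp only [Finset.sum_const, nsmul_eq_mul, mul_one, one_mul, Finset.card_univ,
    Fintype.card_fin] at e0 e2
  clear e3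
  rw [ncard_Aw, ncard_Aw]
  have hq := arithN _ _ _ _ _ e0 e1 e2 p3
  have key : Module.finrank (ZMod 2) C = 8 ∨ Module.finrank (ZMod 2) C = 9 := by
    obtain ⟨l1, l2, -⟩ := hq
    rw [hk] at l1 l2
    have := (Nat.pow_lt_pow_iff_right (a := 2) (by norm_num)).1 l1
    have := (Nat.pow_lt_pow_iff_right (a := 2) (by norm_num)).1 l2
    omega
  rcases key with k | k
  · rw [k] at hk
    norm_num at hk
    obtain ⟨a8, a16, a24, a32⟩ := arith8 _ _ _ _ _ hk e0 e1 e2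
    refine ⟨k, ?_, a24, a32⟩
    intro c hc hne
    have hp := Aw_pos C c hc
    rcases hw c hc with h | h | h | h | h
    · exact absurd ((hwt_zero_iff c).1 h) hne
    · rw [h] at hp; exact absurd a8 hp
    · rw [h] at hp; exact absurd a16 hp
    · exact Or.inl h
    · exact Or.inr h
  · exfalso
    rw [k] at hk
    norm_num at hk
    obtain ⟨a8, a16⟩ := hq.2.2 hk
    have a8' := a8
    unfold Aw at a8'
    obtain ⟨x, y, hxy, hs⟩ := Finset.card_eq_two.1 a8'
    have hm : ∀ c, (c ∈ C ∧ hwt c = 8) ↔ (c = x ∨ c = y) := by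
      intro c
      have : c ∈ (codeF C).filter (fun c => hwt c = 8) ↔ c ∈ ({x, y} : Finset _) := by rw [hs]
      simpa [mem_codeF] using this
    obtain ⟨hx, hx8⟩ := (hm x).2 (Or.inl rfl)
    obtain ⟨hy, hy8⟩ := (hm y).2 (Or.inr rfl)
    have hxyC := C.add_mem hx hy
    have hadd := hwt_add x y
    have hp := Aw_pos C _ hxyC
    have hne0 : hwt (x + y) ≠ 0 := by
      rw [Ne, hwt_zero_iff]
      intro h
      apply hxy
      funext i
      have := congrFun h i
      exact CharTwo.add_eq_zero.1 this
    have hne16 : hwt (x + y) ≠ 16 := by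
      intro h; rw [h] at hp; exact hp a16
    have h8 : hwt (x + y) = 8 := by
      rcases hw _ hxyC with h | h | h | h | h <;> omega
    rcases (hm _).1 ⟨hxyC, h8⟩ with h | h
    · have : y = 0 := by simpa using h
      rw [(hwt_zero_iff y).2 this] at hy8; omega
    · have : x = 0 := by simpa using h
      rw [(hwt_zero_iff x).2 this] at hx8; omega
end

section
/- Let C be a binary linear code of length n that is 2^r-divisible for some r ≥ 1, and let c ∈ C. Then the residual code of C with respect to c is 2^(r−1)-divisible; concretely, for every codeword c' ∈ C, the number of coordinates i with c_i = 0 and c'_i ≠ 0 is divisible by 2^(r−1). -/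
/-- The residual code of a `2^r`-divisible binary linear code with respect to a codeword
is `2^(r−1)`-divisible. -/
theorem residual_divisible (n r : ℕ) (hr : 1 ≤ r)
    (C : Submodule (ZMod 2) (Fin n → ZMod 2))
    (hdiv : ∀ c ∈ C, 2 ^ r ∣ hwt c)
    (c : Fin n → ZMod 2) (hc : c ∈ C) :
    ∀ c' ∈ C, 2 ^ (r - 1) ∣ (Finset.univ.filter fun i => c i = 0 ∧ c' i ≠ 0).card := by
  intro c' hc'
  have key : hwt c' + hwt (c + c') =
      hwt c + 2 * (Finset.univ.filter fun i => c i = 0 ∧ c' i ≠ 0).card := by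
    unfold hwt
    simp only [Finset.card_filter, Finset.mul_sum, ← Finset.sum_add_distrib, Pi.add_apply]
    refine Finset.sum_congr rfl fun i _ => ?_
    generalize c i = a
    generalize c' i = b
    revert a b
    decide
  obtain ⟨s, rfl⟩ : ∃ s, r = s + 1 := ⟨r - 1, by omega⟩
  have h1 := dvd_add (hdiv c' hc') (hdiv (c + c') (C.add_mem hc hc'))
  rw [key, Nat.dvd_add_right (hdiv c hc), pow_succ, mul_comm] at h1
  exact Nat.dvd_of_mul_dvd_mul_left (by norm_num) h1
end
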